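/- Let X be a separable infinite dimensional elastic Banach space. Then the Banach space C([0,1]) of continuous real-valued functions on [0,1] with the supremum norm embeds isomorphically into X, i.e., there is a bounded linear injection T : C([0,1]) → X that is bounded below. -/

import Mathlib

/-- An isomorphic embedding of Banach spaces: a bounded linear map which is
bounded below (hence an isomorphism onto its range). -/
def IsIsomorphicEmbedding {Y X : Type*} [NormedAddCommGroup Y] [NormedSpace ℝ Y]
    [NormedAddCommGroup X] [NormedSpace ℝ X] (T : Y →L[ℝ] X) : Prop :=
  ∃ c : ℝ, 0 < c ∧ ∀ y : Y, c * ‖y‖ ≤ ‖T y‖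

/-- `Y` embeds isomorphically into `X`. -/
def EmbedsInto (Y X : Type*) [NormedAddCommGroup Y] [NormedSpace ℝ Y]
    [NormedAddCommGroup X] [NormedSpace ℝ X] : Prop :=
  ∃ T : Y →L[ℝ] X, IsIsomorphicEmbedding T

/-- `X` is `K`-elastic: whenever a Banach space `Y` embeds isomorphically into `X`,
there is an embedding `T : Y → X` with `‖y‖ ≤ ‖T y‖ ≤ K * ‖y‖` for all `y`. -/
def IsKElastic (X : Type*) [NormedAddCommGroup X] [NormedSpace ℝ X] (K : ℝ) : Prop :=
  ∀ (Y : Type) [NormedAddCommGroup Y] [NormedSpace ℝ Y] [CompleteSpace Y],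
    EmbedsInto Y X → ∃ T : Y →L[ℝ] X, ∀ y : Y, ‖y‖ ≤ ‖T y‖ ∧ ‖T y‖ ≤ K * ‖y‖

namespace ElC

open Filter Topology

/-! ### Basic tools -/

theorem hb {V X : Type*} [AddCommGroup V] [Module ℝ V] [NormedAddCommGroup X] [NormedSpace ℝ X]
    (E : V →ₗ[ℝ] X) (L : V →ₗ[ℝ] ℝ) (M : ℝ) (hM : 0 ≤ M)
    (h : ∀ x, |L x| ≤ M * ‖E x‖) :
    ∃ f : X →L[ℝ] ℝ, ‖f‖ ≤ M ∧ ∀ x, f (E x) = L x := by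
  have hk : LinearMap.ker E ≤ LinearMap.ker L := by
    intro x hx
    have h1 := h x
    rw [LinearMap.mem_ker.1 hx] at h1
    simpa using h1
  let g : LinearMap.range E →ₗ[ℝ] ℝ :=
    ((LinearMap.ker E).liftQ L hk).comp E.quotKerEquivRange.symm.toLinearMap
  have hg : ∀ x, g ⟨E x, LinearMap.mem_range_self E x⟩ = L x := by
    intro x
    have : E.quotKerEquivRange.symm ⟨E x, LinearMap.mem_range_self E x⟩
        = (LinearMap.ker E).mkQ x := by
      rw [LinearEquiv.symm_apply_eq]
      rfl
    simp only [g, LinearMap.comp_apply, LinearEquiv.coe_coe, this]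
    simp
  have hb : ∀ y, ‖g y‖ ≤ M * ‖y‖ := by
    rintro ⟨_, x, rfl⟩
    rw [hg]
    exact h x
  obtain ⟨f, hf1, hf2⟩ := exists_extension_norm_eq (LinearMap.range E) (g.mkContinuous M hb)
  refine ⟨f, hf2 ▸ LinearMap.mkContinuous_norm_le _ hM _, fun x => ?_⟩
  have := hf1 ⟨E x, LinearMap.mem_range_self E x⟩
  simp only [LinearMap.mkContinuous_apply, hg] at this
  exact this

theorem reset {V X L : Type} [AddCommGroup V] [Module ℝ V] [NormedAddCommGroup X]
    [NormedSpace ℝ X] [CompleteSpace X] {K : ℝ} (hK : IsKElastic X K) (hK1 : 0 ≤ K)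
    (E : V →ₗ[ℝ] X) (Λ : L → V →ₗ[ℝ] ℝ) (M C : ℝ) (hM : 0 ≤ M) (hC : 0 < C)
    (h : ∀ l x, |Λ l x| ≤ M * ‖E x‖) :
    ∃ A : X →ₗ[ℝ] X, (∀ l x, |Λ l x| ≤ ‖A (E x)‖) ∧
      ∀ x B, 0 ≤ B → (∀ l, |Λ l x| ≤ B) → ‖E x‖ ≤ C * B → ‖A (E x)‖ ≤ K * B := by
  choose f hfM hf using fun l => hb E (Λ l) M hM (h l)
  have hfb : ∀ l y, ‖f l y‖ ≤ M * ‖y‖ := fun l y =>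
    (f l).le_of_opNorm_le (hfM l) y
  have hmem : ∀ y, Memℓp (fun l => f l y) ⊤ := fun y =>
    memℓp_infty ⟨M * ‖y‖, by rintro _ ⟨l, rfl⟩; exact hfb l y⟩
  let J1 : X →ₗ[ℝ] lp (fun _ : L => ℝ) ⊤ :=
    { toFun := fun y => ⟨fun l => f l y, hmem y⟩
      map_add' := fun y z => by ext l; simp; rfl
      map_smul' := fun c y => by ext l; simp }
  have hJ1 : ∀ y, ‖J1 y‖ ≤ M * ‖y‖ := fun y =>
    lp.norm_le_of_forall_le (by positivity) (fun l => hfb l y)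
  let J : X →ₗ[ℝ] lp (fun _ : L => ℝ) ⊤ × X := J1.prod (C⁻¹ • LinearMap.id)
  have hCi : 0 < C⁻¹ := inv_pos.2 hC
  have hJn : ∀ y, ‖J y‖ = max ‖J1 y‖ (C⁻¹ * ‖y‖) := by
    intro y
    simp [J, Prod.norm_def, norm_smul, abs_of_pos hC]
  have hJb : ∀ y, ‖J y‖ ≤ (max M C⁻¹) * ‖y‖ := by
    intro y
    rw [hJn]
    apply max_le
    · exact (hJ1 y).trans (by gcongr; exact le_max_left _ _)
    · gcongr; exact le_max_right _ _
  let Jc := J.mkContinuous _ hJb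
  have hanti : AntilipschitzWith (C.toNNReal) Jc := by
    apply ContinuousLinearMap.antilipschitz_of_bound
    intro y
    rw [Real.coe_toNNReal _ hC.le]
    have : C⁻¹ * ‖y‖ ≤ ‖J y‖ := by rw [hJn]; exact le_max_right _ _
    calc ‖y‖ = C * (C⁻¹ * ‖y‖) := by field_simp
      _ ≤ C * ‖J y‖ := by gcongr
  have hcl : IsClosed (Set.range Jc) := hanti.isClosed_range Jc.uniformContinuous
  let Y := LinearMap.range Jc.toLinearMap
  have hcl' : IsClosed (Y : Set (lp (fun _ : L => ℝ) ⊤ × X)) := by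
    simpa [Y, LinearMap.coe_range] using hcl
  have : CompleteSpace Y := hcl'.completeSpace_coe
  have hemb : EmbedsInto Y X := by
    refine ⟨(ContinuousLinearMap.snd ℝ _ _).comp Y.subtypeL, ?_⟩
    refine ⟨C⁻¹ * (max M C⁻¹)⁻¹, by positivity, ?_⟩
    rintro ⟨_, y, rfl⟩
    have e1 : ‖((ContinuousLinearMap.snd ℝ (lp (fun _ : L => ℝ) ⊤) X).comp Y.subtypeL)
        ⟨Jc y, LinearMap.mem_range_self _ y⟩‖ = C⁻¹ * ‖y‖ := by
      simp [Jc, J, norm_smul, abs_of_pos hC]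
    have e2 : ‖(⟨Jc y, LinearMap.mem_range_self _ y⟩ : Y)‖ = ‖J y‖ := rfl
    have hp : 0 < max M C⁻¹ := lt_max_of_lt_right hCi
    refine le_trans ?_ (le_of_eq e1.symm)
    change C⁻¹ * (max M C⁻¹)⁻¹ * ‖J y‖ ≤ _
    rw [mul_assoc]
    gcongr
    rw [inv_mul_le_iff₀ hp]
    exact hJb y
  obtain ⟨T, hT⟩ := hK Y hemb
  refine ⟨T.toLinearMap.comp (Jc.toLinearMap.rangeRestrict), ?_, ?_⟩
  · intro l x
    have h1 := (hT (Jc.toLinearMap.rangeRestrict (E x))).1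
    refine le_trans ?_ h1
    change _ ≤ ‖J (E x)‖
    rw [hJn, ← hf]
    exact le_trans (lp.norm_apply_le_norm (by simp) (J1 (E x)) l) (le_max_left _ _)
  · intro x B hB hl hE
    have h1 := (hT (Jc.toLinearMap.rangeRestrict (E x))).2
    refine h1.trans ?_
    gcongr
    change ‖J (E x)‖ ≤ _
    rw [hJn]
    apply max_le
    · apply lp.norm_le_of_forall_le hB
      intro l
      change ‖f l (E x)‖ ≤ B
      rw [hf]; exact hl l
    · rw [inv_mul_le_iff₀ hC]; exact hE

theorem weak_lim {X : Type*} [NormedAddCommGroup X] [NormedSpace ℝ X] (f : ℕ → X →L[ℝ] ℝ) (M : ℝ)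
    (hM : 0 ≤ M) (hf : ∀ m, ‖f m‖ ≤ M) :
    ∃ g : X →L[ℝ] ℝ, ‖g‖ ≤ M ∧ ∀ x, Tendsto (fun m => f m x) (hyperfilter ℕ) (𝓝 (g x)) := by
  have hx : ∀ x, ∃ y, |y| ≤ M * ‖x‖ ∧ Tendsto (fun m => f m x) (hyperfilter ℕ) (𝓝 y) := by
    intro x
    have hc : IsCompact (Metric.closedBall (0:ℝ) (M * ‖x‖)) := isCompact_closedBall _ _
    have := hc.ultrafilter_le_nhds ((hyperfilter ℕ).map (fun m => f m x)) (by
      rw [le_principal_iff, Ultrafilter.mem_coe, Ultrafilter.mem_map]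
      refine Filter.univ_mem' (fun m => ?_)
      simp only [Set.mem_preimage, mem_closedBall_zero_iff]
      exact (f m).le_of_opNorm_le (hf m) x)
    obtain ⟨y, hy, hy2⟩ := this
    exact ⟨y, by simpa using hy, hy2⟩
  choose g hg1 hg2 using hx
  let G : X →ₗ[ℝ] ℝ :=
    { toFun := g
      map_add' := fun x y => tendsto_nhds_unique (hg2 (x + y)) (by
        simpa using (hg2 x).add (hg2 y))
      map_smul' := fun c x => tendsto_nhds_unique (hg2 (c • x)) (by
        simpa using (hg2 x).const_mul c) }
  exact ⟨G.mkContinuous M hg1, LinearMap.mkContinuous_norm_le _ hM _, hg2⟩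

theorem lim_exists (a : ℕ → ℝ) (M : ℝ) (ha : ∀ m, |a m| ≤ M) :
    ∃ y, Tendsto a (hyperfilter ℕ) (𝓝 y) := by
  have hc : IsCompact (Metric.closedBall (0:ℝ) M) := isCompact_closedBall _ _
  obtain ⟨y, hy, hy2⟩ := hc.ultrafilter_le_nhds ((hyperfilter ℕ).map a) (by
      rw [le_principal_iff, Ultrafilter.mem_coe, Ultrafilter.mem_map]
      refine Filter.univ_mem' (fun m => ?_)
      simpa using ha m)
  exact ⟨y, hy2⟩

theorem seq_choice {Z : Type*} [Inhabited Z] (Q : ℕ → (ℕ → Z) → Z → Prop)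
    (hQ : ∀ n f g z, (∀ k < n, f k = g k) → Q n f z → Q n g z)
    (h : ∀ n f, (∀ k < n, Q k f (f k)) → ∃ z, Q n f z) :
    ∃ f : ℕ → Z, ∀ n, Q n f (f n) := by
  classical
  -- build finite approximations
  have step : ∀ n (f : ℕ → Z), ∃ z, (∀ k < n, Q k f (f k)) → Q n f z := by
    intro n f
    by_cases hf : ∀ k < n, Q k f (f k)
    · obtain ⟨z, hz⟩ := h n f hf
      exact ⟨z, fun _ => hz⟩
    · exact ⟨default, fun h => absurd h hf⟩
  choose s hs using step
  let F : ℕ → (ℕ → Z) := fun n => Nat.rec (fun _ => default)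
    (fun n f => Function.update f n (s n f)) n
  have hF : ∀ n, F (n+1) = Function.update (F n) n (s n (F n)) := fun n => rfl
  have hF2 : ∀ k n, k < n → F n k = F (k+1) k := by
    intro k n hkn
    induction n with
    | zero => omega
    | succ n ih =>
      rcases Nat.lt_succ_iff_lt_or_eq.1 hkn with h1 | h1
      · rw [hF, Function.update_of_ne (by omega), ih h1]
      · subst h1; rfl
  refine ⟨fun k => F (k+1) k, ?_⟩
  intro n
  induction n using Nat.strong_induction_on with
  | _ n ih =>
    have h1 : ∀ k < n, Q k (F n) (F n k) := by
      intro k hk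
      rw [hF2 k n hk]
      exact hQ k _ _ _ (fun j hj => (hF2 j n (hj.trans hk)).symm) (ih k hk)
    have h2 := hs n (F n) h1
    have h3 : F (n+1) n = s n (F n) := by rw [hF]; simp
    change Q n _ (F (n+1) n)
    rw [h3]
    exact hQ n _ _ _ (fun j hj => (hF2 j n hj)) h2

/-! ### Systems of vectors -/

noncomputable def ind {ι : Type*} (A : Set ι) : (ι →₀ ℝ) →ₗ[ℝ] ℝ :=
  Finsupp.linearCombination ℝ (Set.indicator A (fun _ => (1:ℝ)))

noncomputable def LC {ι X : Type*} [NormedAddCommGroup X] [NormedSpace ℝ X] (e : ι → X) :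
    (ι →₀ ℝ) →ₗ[ℝ] X := Finsupp.linearCombination ℝ e

theorem ind_mapDomain {ι ι' : Type*} (k : ι → ι') (A : Set ι') (x : ι →₀ ℝ) :
    ind A (Finsupp.mapDomain k x) = ind (k ⁻¹' A) x := by
  unfold ind
  rw [Finsupp.linearCombination_mapDomain]
  rfl

theorem LC_mapDomain {ι ι' X : Type*} [NormedAddCommGroup X] [NormedSpace ℝ X]
    (k : ι → ι') (e : ι' → X) (x : ι →₀ ℝ) :
    LC e (Finsupp.mapDomain k x) = LC (e ∘ k) x := by
  unfold LC
  rw [Finsupp.linearCombination_mapDomain]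

theorem ind_singleton {ι : Type*} (i : ι) (x : ι →₀ ℝ) : ind {i} x = x i := by
  classical
  unfold ind
  rw [Finsupp.linearCombination_apply, Finsupp.sum]
  simp [Set.indicator_apply]
  tauto

theorem ind_single {ι : Type*} (A : Set ι) (i : ι) (c : ℝ) :
    ind A (Finsupp.single i c) = c * A.indicator (fun _ => (1:ℝ)) i := by
  simp [ind]

theorem LC_single {ι X : Type*} [NormedAddCommGroup X] [NormedSpace ℝ X]
    (e : ι → X) (i : ι) (c : ℝ) :
    LC e (Finsupp.single i c) = c • e i := by
  simp [LC]

theorem ind_congr {ι : Type*} {A B : Set ι} {x : ι →₀ ℝ} (h : ∀ i, x i ≠ 0 → (i ∈ A ↔ i ∈ B)) :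
    ind A x = ind B x := by
  classical
  unfold ind
  rw [Finsupp.linearCombination_apply, Finsupp.linearCombination_apply]
  apply Finsupp.sum_congr
  intro i hi
  rw [Finsupp.mem_support_iff] at hi
  simp only [Set.indicator_apply, h i hi]

theorem ind_eq_zero {ι : Type*} {A : Set ι} {x : ι →₀ ℝ} (h : ∀ i, x i ≠ 0 → i ∉ A) :
    ind A x = 0 := by
  rw [ind_congr (B := ∅) (fun i hi => by simp [h i hi])]
  simp [ind, Finsupp.linearCombination_apply]

theorem LC_congr {ι X : Type*} [NormedAddCommGroup X] [NormedSpace ℝ X]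
    {e e' : ι → X} {x : ι →₀ ℝ} (h : ∀ i, x i ≠ 0 → e i = e' i) : LC e x = LC e' x := by
  unfold LC
  rw [Finsupp.linearCombination_apply, Finsupp.linearCombination_apply]
  apply Finsupp.sum_congr
  intro i hi
  rw [Finsupp.mem_support_iff] at hi
  rw [h i hi]

theorem mem_supp_iff {ι : Type*} {I : Set ι} {x : ι →₀ ℝ} :
    x ∈ Finsupp.supported ℝ ℝ I ↔ ∀ i, x i ≠ 0 → i ∈ I := by
  rw [Finsupp.mem_supported]
  simp [Set.subset_def]

def Lower {ι X : Type*} [NormedAddCommGroup X] [NormedSpace ℝ X] (e : ι → X) (I : Set ι)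
    (A : Set (Set ι)) (M : ℝ) : Prop :=
  ∀ x ∈ Finsupp.supported ℝ ℝ I, ∀ S ∈ A, |ind S x| ≤ M * ‖LC e x‖

def Upper {ι X : Type*} [NormedAddCommGroup X] [NormedSpace ℝ X] (e : ι → X)
    (V : Set (ι →₀ ℝ)) (A : Set (Set ι)) (C : ℝ) : Prop :=
  ∀ x ∈ V, ∀ B, 0 ≤ B → (∀ S ∈ A, |ind S x| ≤ B) → ‖LC e x‖ ≤ C * B

/-- The set of finitely supported functions supported on `I`. -/
def spt {ι : Type*} (I : Set ι) : Set (ι →₀ ℝ) := {x | ∀ i, x i ≠ 0 → i ∈ I}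

theorem spt_iff {ι : Type*} {I : Set ι} {x : ι →₀ ℝ} :
    x ∈ Finsupp.supported ℝ ℝ I ↔ x ∈ spt I := mem_supp_iff

theorem reset_sys {X ι : Type} [NormedAddCommGroup X]
    [NormedSpace ℝ X] [CompleteSpace X] {K : ℝ} (hK : IsKElastic X K) (hK1 : 0 ≤ K)
    (e : ι → X) (I : Set ι) (A : Set (Set ι)) (V : Set (ι →₀ ℝ)) (M C : ℝ) (hM : 0 ≤ M)
    (hV : V ⊆ spt I) (hl : Lower e I A M) (hu : Upper e V A C) :
    ∃ e' : ι → X, Lower e' I A 1 ∧ Upper e' V A K := by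
  have hh : ∀ (S : A) (x : Finsupp.supported ℝ ℝ I),
      |(ind S.1).domRestrict (Finsupp.supported ℝ ℝ I) x|
        ≤ M * ‖(LC e).domRestrict (Finsupp.supported ℝ ℝ I) x‖ :=
    fun S x => hl x.1 x.2 S.1 S.2
  obtain ⟨F, h1, h2⟩ := reset (L := A) (V := Finsupp.supported ℝ ℝ I) hK hK1 ((LC e).domRestrict (Finsupp.supported ℝ ℝ I))
    (fun S => (ind S.1).domRestrict (Finsupp.supported ℝ ℝ I)) M (max C 1) hM (by positivity) hh
  have hF : ∀ x, F (LC e x) = LC (fun i => F (e i)) x := by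
    intro x
    unfold LC
    rw [Finsupp.linearCombination_apply, Finsupp.linearCombination_apply]
    simp [Finsupp.sum, map_sum]
  refine ⟨fun i => F (e i), ?_, ?_⟩
  · intro x hx S hS
    have := h1 ⟨S, hS⟩ ⟨x, hx⟩
    rw [← hF, one_mul]
    exact this
  · intro x hx B hB hxB
    have hx' := spt_iff.2 (hV hx)
    have := h2 ⟨x, hx'⟩ B hB (fun S => hxB S.1 S.2) ((hu x hx B hB hxB).trans (by
      gcongr; exact le_max_left _ _))
    rw [← hF]
    exact this

theorem IsKElastic.mono {X : Type} [NormedAddCommGroup X] [NormedSpace ℝ X] {K K' : ℝ}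
    (hK : IsKElastic X K) (h : K ≤ K') : IsKElastic X K' := by
  intro Y _ _ _ hY
  obtain ⟨T, hT⟩ := hK Y hY
  exact ⟨T, fun y => ⟨(hT y).1, (hT y).2.trans (by gcongr)⟩⟩

end ElC


namespace ElC

open Filter Topology

/-! ### Lists and trees -/

def suf (j : ℕ) (r : List ℕ) : List ℕ := r.drop (r.length - j)

theorem suf_cons {j : ℕ} {a : ℕ} {r : List ℕ} (h : j ≤ r.length) : suf j (a :: r) = suf j r := by
  unfold suf
  rw [List.length_cons, show r.length + 1 - j = (r.length - j) + 1 by omega]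
  rfl

theorem suf_self {j : ℕ} {r : List ℕ} (h : r.length ≤ j) : suf j r = r := by
  unfold suf
  rw [show r.length - j = 0 by omega]
  rfl

theorem suf_suffix (j : ℕ) (r : List ℕ) : suf j r <:+ r := List.drop_suffix _ _

theorem length_suf (j : ℕ) (r : List ℕ) : (suf j r).length = min j r.length := by
  simp [suf]; omega

theorem suf_eq {s r : List ℕ} (h : s <:+ r) : suf s.length r = s := by
  apply List.IsSuffix.eq_of_length
  · exact List.suffix_of_suffix_length_le (suf_suffix _ _) h (by rw [length_suf]; omega)
  · rw [length_suf]; have := h.length_le; omega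

theorem suf_suf {j k : ℕ} {r : List ℕ} (h : j ≤ k) : suf j (suf k r) = suf j r := by
  have h1 : suf j (suf k r) <:+ r := (suf_suffix _ _).trans (suf_suffix _ _)
  apply List.IsSuffix.eq_of_length
  · exact List.suffix_of_suffix_length_le h1 (suf_suffix _ _) (by simp only [length_suf]; omega)
  · simp only [length_suf]; omega

def ev (r : List ℕ) (j : ℕ) : ℕ := r.reverse.getD j 0

theorem ev_cons {a : ℕ} {r : List ℕ} {j : ℕ} (h : j < r.length) : ev (a :: r) j = ev r j := by
  unfold ev
  rw [List.reverse_cons, List.getD_append _ _ _ _ (by simpa using h)]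

theorem ev_cons_self {a : ℕ} {r : List ℕ} : ev (a :: r) r.length = a := by
  unfold ev
  rw [List.reverse_cons, List.getD_append_right _ _ _ _ (by simp)]
  simp

/-- suffix closed -/
def SC (R : Set (List ℕ)) : Prop := ∀ a l, a :: l ∈ R → l ∈ R
/-- upwards closed -/
def UC (R : Set (List ℕ)) : Prop := ∀ l l', l ∈ R → List.Forall₂ (· ≤ ·) l l' → l' ∈ R
/-- no infinite branch -/
def WF (R : Set (List ℕ)) : Prop := WellFounded (fun l' l : List ℕ => l' ∈ R ∧ ∃ a, l' = a :: l)

theorem SC.suffix {R : Set (List ℕ)} (h : SC R) {l l' : List ℕ} (hl : l' ∈ R) (hs : l <:+ l') :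
    l ∈ R := by
  obtain ⟨t, rfl⟩ := hs
  induction t with
  | nil => exact hl
  | cons a t ih => exact ih (h _ _ hl)

theorem wf_of_no_chain {R : Set (List ℕ)}
    (h : ∀ f : ℕ → List ℕ, (∀ n, f (n+1) ∈ R ∧ ∃ a, f (n+1) = a :: f n) → False) : WF R := by
  unfold WF
  rw [wellFounded_iff_isEmpty_descending_chain]
  exact ⟨fun f => h f.1 f.2⟩

theorem WF.no_chain {R : Set (List ℕ)} (hR : WF R) (f : ℕ → List ℕ)
    (h : ∀ n, f (n+1) ∈ R ∧ ∃ a, f (n+1) = a :: f n) : False := by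
  unfold WF at hR
  rw [wellFounded_iff_isEmpty_descending_chain] at hR
  exact hR.false ⟨f, h⟩

theorem chain_length {f : ℕ → List ℕ} (h : ∀ n, ∃ a, f (n+1) = a :: f n) (n : ℕ) :
    (f n).length = (f 0).length + n := by
  induction n with
  | zero => rfl
  | succ n ih =>
    obtain ⟨a, ha⟩ := h n
    rw [ha, List.length_cons, ih]; omega

theorem chain_suffix {f : ℕ → List ℕ} (h : ∀ n, ∃ a, f (n+1) = a :: f n) {m n : ℕ} (hmn : m ≤ n) :
    f m <:+ f n := by
  induction n, hmn using Nat.le_induction with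
  | base => exact List.suffix_rfl
  | succ n _ ih =>
    obtain ⟨a, ha⟩ := h n
    rw [ha]; exact ih.trans (List.suffix_cons _ _)

def up (T : Set (List ℕ)) : Set (List ℕ) := {l' | ∃ l ∈ T, List.Forall₂ (· ≤ ·) l l'}

theorem subset_up (T : Set (List ℕ)) : T ⊆ up T := fun l hl =>
  ⟨l, hl, List.forall₂_refl l⟩

theorem up_SC {T : Set (List ℕ)} (h : SC T) : SC (up T) := by
  rintro a l ⟨l', hl', h2⟩
  cases h2 with
  | cons h3 h4 => exact ⟨_, h _ _ hl', h4⟩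

theorem up_UC (T : Set (List ℕ)) : UC (up T) := by
  rintro l l' ⟨l0, hl0, h2⟩ h3
  refine ⟨l0, hl0, ?_⟩
  clear hl0
  induction h3 generalizing l0 with
  | nil => exact h2
  | cons h4 _ ih =>
    cases h2 with
    | cons h5 h6 => exact List.Forall₂.cons (h5.trans h4) (ih _ h6)

theorem forall2_suf {l l' : List ℕ} (h : List.Forall₂ (· ≤ ·) l l') (j : ℕ) :
    List.Forall₂ (· ≤ ·) (suf j l) (suf j l') := by
  unfold suf
  rw [h.length_eq]
  exact List.forall₂_drop _ h

theorem up_WF {T : Set (List ℕ)} (h : SC T) (hw : WF T) : WF (up T) := by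
  apply wf_of_no_chain
  intro f hf
  have hf2 := fun n => (hf n).2
  have key : ∀ l, ∃ N : ℕ, ∀ l' ∈ T, l <:+ l' → (∃ n, List.Forall₂ (· ≤ ·) l' (f n)) →
      l'.length ≤ N := by
    intro l
    induction l using hw.induction with
    | _ l ih =>
      have ih2 : ∀ a, ∃ N : ℕ, ∀ l' ∈ T, (a :: l) <:+ l' →
          (∃ n, List.Forall₂ (· ≤ ·) l' (f n)) → l'.length ≤ N := by
        intro a
        by_cases ha : a :: l ∈ T
        · exact ih (a :: l) ⟨ha, a, rfl⟩
        · exact ⟨0, fun l' hl' hs => absurd (h.suffix hl' hs) ha⟩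
      choose N hN using ih2
      let S := (f (l.length + 1)).sum
      refine ⟨l.length + (Finset.range (S+1)).sup N, ?_⟩
      rintro l' hl' hs ⟨n, hn⟩
      by_cases hle : l'.length ≤ l.length
      · omega
      -- the next element
      have hs1 : suf l.length l' = l := suf_eq hs
      obtain ⟨a, ha⟩ : ∃ a, suf (l.length + 1) l' = a :: l := by
        have hlen : (suf (l.length + 1) l').length = l.length + 1 := by rw [length_suf]; omega
        match hh : suf (l.length + 1) l' with
        | [] => rw [hh] at hlen; simp at hlen
        | a :: t =>
          refine ⟨a, ?_⟩
          rw [hh] at hlen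
          have h3 : suf l.length (suf (l.length + 1) l') = l := by rw [suf_suf (by omega), hs1]
          rw [hh, suf_cons (by simp at hlen; omega), suf_self (by simp at hlen; omega)] at h3
          rw [h3]
      have h4 := forall2_suf hn (l.length + 1)
      rw [ha] at h4
      have hlen := hn.length_eq
      have h5 : ∃ c, a ≤ c ∧ c ∈ f (l.length + 1) := by
        have h6 : suf (l.length + 1) (f n) <:+ f (l.length + 1) := by
          rcases le_total n (l.length + 1) with h7 | h7
          · exact (suf_suffix _ _).trans (chain_suffix hf2 h7)
          · apply List.suffix_of_suffix_length_le (suf_suffix _ _) (chain_suffix hf2 h7)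
            rw [length_suf, chain_length hf2 (l.length + 1)]
            omega
        cases hh : suf (l.length + 1) (f n) with
        | nil => rw [hh] at h4; cases h4
        | cons c t =>
          rw [hh] at h4 h6
          cases h4 with
          | cons h8 h9 => exact ⟨c, h8, h6.subset (by simp)⟩
      obtain ⟨c, hc1, hc2⟩ := h5
      have hcS : c ≤ S := List.le_sum_of_mem hc2
      have h10 := hN a l' hl' (ha ▸ suf_suffix _ _) ⟨n, hn⟩
      have h11 : N a ≤ (Finset.range (S+1)).sup N :=
        Finset.le_sup (f := N) (Finset.mem_range.2 (by omega))
      omega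
  obtain ⟨N, hN⟩ := key []
  obtain ⟨l, hl, hl2⟩ := (hf N).1
  have := hN l hl (List.nil_suffix) ⟨_, hl2⟩
  have h2 := hl2.length_eq
  rw [chain_length hf2] at h2
  omega

/-! ### The closing lemma -/

theorem sum_geo {ι : Type*} [Encodable ι] (s : Finset ι) :
    ∑ i ∈ s, (1/2 : ℝ) ^ (Encodable.encode i) ≤ 2 := by
  classical
  have h1 : ∑ i ∈ s, (1/2 : ℝ) ^ (Encodable.encode i)
      = ∑ n ∈ s.image Encodable.encode, (1/2 : ℝ) ^ n := by
    rw [Finset.sum_image]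
    intro a _ b _ h
    exact Encodable.encode_injective h
  rw [h1]
  refine le_trans ?_ (le_of_eq tsum_geometric_two)
  exact summable_geometric_two.sum_le_tsum _ (fun _ _ => by positivity)

theorem perturb {ι X : Type*} [Encodable ι] [NormedAddCommGroup X] [NormedSpace ℝ X]
    (v w : ι → X) (x : ι →₀ ℝ) (b δ : ℝ) (hb : 0 ≤ b) (hδ : 0 ≤ δ) (hx : ∀ i, |x i| ≤ b)
    (h : ∀ i, x i ≠ 0 → ‖v i - w i‖ ≤ δ * (1/2 : ℝ) ^ (Encodable.encode i)) :
    ‖LC v x - LC w x‖ ≤ 2 * b * δ := by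
  unfold LC
  rw [Finsupp.linearCombination_apply, Finsupp.linearCombination_apply, Finsupp.sum, Finsupp.sum,
    ← Finset.sum_sub_distrib]
  calc ‖∑ i ∈ x.support, (x i • v i - x i • w i)‖
      ≤ ∑ i ∈ x.support, ‖x i • v i - x i • w i‖ := norm_sum_le _ _
    _ ≤ ∑ i ∈ x.support, b * δ * (1/2 : ℝ) ^ (Encodable.encode i) := by
        apply Finset.sum_le_sum
        intro i hi
        rw [← smul_sub, norm_smul, mul_assoc]
        gcongr
        · exact hx i
        · exact h i (Finsupp.mem_support_iff.1 hi)
    _ = b * δ * ∑ i ∈ x.support, (1/2 : ℝ) ^ (Encodable.encode i) := by rw [Finset.mul_sum]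
    _ ≤ b * δ * 2 := by gcongr; exact sum_geo _
    _ = 2 * b * δ := by ring

theorem Lower.mono_I {ι X : Type*} [NormedAddCommGroup X] [NormedSpace ℝ X] {e : ι → X}
    {I J : Set ι} {A : Set (Set ι)} {M : ℝ} (h : Lower e I A M) (hJ : J ⊆ I) : Lower e J A M :=
  fun x hx => h x (Finsupp.supported_mono hJ hx)

theorem Upper.mono_V {ι X : Type*} [NormedAddCommGroup X] [NormedSpace ℝ X] {e : ι → X}
    {V W : Set (ι →₀ ℝ)} {A : Set (Set ι)} {M : ℝ} (h : Upper e V A M) (hJ : W ⊆ V) :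
    Upper e W A M :=
  fun x hx => h x (hJ hx)

theorem spt_mono {ι : Type*} {I J : Set ι} (h : I ⊆ J) : spt I ⊆ spt J :=
  fun _ hx i hi => h (hx i hi)

theorem closing {X ι : Type} [NormedAddCommGroup X] [NormedSpace ℝ X]
    [TopologicalSpace.SeparableSpace X] [Encodable ι] (I : Set ι) (A : Set (Set ι)) (K : ℝ)
    (hK0 : 0 ≤ K)
    (hcoord : ∀ x ∈ spt I, ∀ B, 0 ≤ B → (∀ S ∈ A, |ind S x| ≤ B) → ∀ i, |x i| ≤ 2 * B)
    (H : ∀ R : Set (List ℕ), SC R → WF R → ∃ u : List ℕ → X, ∀ r ∈ R,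
      Lower (fun i => u (suf (Encodable.encode i) r)) (I ∩ {i | Encodable.encode i < r.length + 1})
        A 1 ∧
      Upper (fun i => u (suf (Encodable.encode i) r))
        (spt (I ∩ {i | Encodable.encode i < r.length + 1})) A K) :
    ∃ v : ι → X, Lower v I A 2 ∧ Upper v (spt I) A (K + 1) := by
  let D := TopologicalSpace.denseSeq X
  have hD : ∀ (x : X) (ε : ℝ), 0 < ε → ∃ a, ‖x - D a‖ ≤ ε := by
    intro x ε hε
    obtain ⟨a, ha⟩ := (TopologicalSpace.denseRange_denseSeq X).exists_dist_lt x hε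
    exact ⟨a, by rw [← dist_eq_norm]; exact ha.le⟩
  let Good : ℕ → (ι → X) → Prop := fun n v =>
    Lower v (I ∩ {i | Encodable.encode i < n}) A 1 ∧
      Upper v (spt (I ∩ {i | Encodable.encode i < n})) A K
  have Gmono : ∀ m n v, m ≤ n → Good n v → Good m v := by
    intro m n v hmn hG
    have hs : I ∩ {i | Encodable.encode i < m} ⊆ I ∩ {i | Encodable.encode i < n} :=
      fun i hi => ⟨hi.1, lt_of_lt_of_le hi.2 hmn⟩
    exact ⟨hG.1.mono_I hs, hG.2.mono_V (spt_mono hs)⟩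
  let ε : ℕ → ℝ := fun n => (1/8) * (1/2 : ℝ) ^ n
  let R : Set (List ℕ) := {r | ∃ v, Good r.length v ∧ ∀ i : ι, Encodable.encode i < r.length →
    ‖v i - D (ev r (Encodable.encode i))‖ ≤ ε (Encodable.encode i)}
  have hSC : SC R := by
    rintro a l ⟨v, hv1, hv2⟩
    refine ⟨v, Gmono _ _ _ (by simp) hv1, fun i hi => ?_⟩
    have := hv2 i (by simp; omega)
    rwa [ev_cons hi] at this
  have hnil : [] ∈ R := by
    refine ⟨fun _ => 0, ?_, fun i hi => by simp at hi⟩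
    have h0 : ∀ x : ι →₀ ℝ, x ∈ spt (I ∩ {i | Encodable.encode i < ([] : List ℕ).length}) →
        x = 0 := by
      intro x hx
      ext i
      by_contra h
      have := (hx i h).2
      simp at this
    constructor
    · intro x hx S hS
      rw [h0 x (spt_iff.1 hx)]
      simp
    · intro x hx B hB hxB
      rw [h0 x hx] at hxB ⊢
      simp only [map_zero, norm_zero]
      positivity
  by_cases hw : WF R
  · exfalso
    obtain ⟨u, hu⟩ := H R hSC hw
    choose nx hnx using fun r : List ℕ => hD (u r) (ε r.length) (by positivity)
    obtain ⟨f, hf0, hf⟩ : ∃ f : ℕ → List ℕ, f 0 = [] ∧ ∀ n, f (n+1) = nx (f n) :: f n :=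
      ⟨fun n => Nat.rec [] (fun _ r => nx r :: r) n, rfl, fun _ => rfl⟩
    have hf2 : ∀ n, ∃ a, f (n+1) = a :: f n := fun n => ⟨_, hf n⟩
    have hlen : ∀ n, (f n).length = n := fun n => by rw [chain_length hf2]; simp [hf0]
    have hsuf : ∀ k n, k ≤ n → suf k (f n) = f k := by
      intro k n hkn
      have := suf_eq (chain_suffix hf2 hkn)
      rwa [hlen] at this
    have hev : ∀ k n, k < n → ev (f n) k = nx (f k) := by
      intro k n hkn
      induction n with
      | zero => omega
      | succ n ih =>
        rcases Nat.lt_succ_iff_lt_or_eq.1 hkn with h1 | h1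
        · rw [hf, ev_cons (by rw [hlen]; exact h1), ih h1]
        · subst h1
          rw [hf]
          have := @ev_cons_self (nx (f k)) (f k)
          rwa [hlen] at this
    have hmem : ∀ n, f n ∈ R := by
      intro n
      induction n with
      | zero => rw [hf0]; exact hnil
      | succ n ih =>
        refine ⟨fun i => u (suf (Encodable.encode i) (f n)), ?_, ?_⟩
        · have := hu (f n) ih
          simp only [Good]
          rw [hf, List.length_cons]
          exact this
        · intro i hi
          rw [hlen] at hi
          have hi' : Encodable.encode i ≤ n := by omega
          change ‖u (suf (Encodable.encode i) (f n)) - _‖ ≤ _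
          rw [hsuf _ _ hi', hev _ _ hi]
          have := hnx (f (Encodable.encode i))
          rwa [hlen] at this
    exact hw.no_chain f (fun n => ⟨hmem _, _, hf n⟩)
  · have : ∃ f : ℕ → List ℕ, (∀ n, f (n+1) ∈ R ∧ ∃ a, f (n+1) = a :: f n) := by
      by_contra hcon
      exact hw (wf_of_no_chain (fun f hf => hcon ⟨f, hf⟩))
    obtain ⟨f, hf⟩ := this
    have hf2 := fun n => (hf n).2
    have hlen := chain_length hf2
    have hev : ∀ k n, k + 1 ≤ n → ev (f n) k = ev (f (k+1)) k := by
      intro k n hkn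
      induction n, hkn using Nat.le_induction with
      | base => rfl
      | succ n hn ih =>
        obtain ⟨a, ha⟩ := hf2 n
        rw [ha, ev_cons (by rw [hlen]; omega), ih]
    let v : ι → X := fun i => D (ev (f (Encodable.encode i + 1)) (Encodable.encode i))
    have key : ∀ x ∈ spt I, ∃ v', (∀ S ∈ A, |ind S x| ≤ 1 * ‖LC v' x‖) ∧
        (∀ B, 0 ≤ B → (∀ S ∈ A, |ind S x| ≤ B) → ‖LC v' x‖ ≤ K * B) ∧
        ∀ i, x i ≠ 0 → ‖v' i - v i‖ ≤ 1/8 * (1/2 : ℝ) ^ (Encodable.encode i) := by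
      intro x hx
      let n := x.support.sup Encodable.encode
      have hn : ∀ i, x i ≠ 0 → Encodable.encode i ≤ n := fun i hi =>
        Finset.le_sup (f := Encodable.encode) (Finsupp.mem_support_iff.2 hi)
      obtain ⟨v', hv1, hv2⟩ := (hf n).1
      have hl : n < (f (n+1)).length := by rw [hlen]; omega
      have hx' : x ∈ spt (I ∩ {i | Encodable.encode i < (f (n+1)).length}) := by
        intro i hi
        exact ⟨hx i hi, lt_of_le_of_lt (hn i hi) hl⟩
      refine ⟨v', hv1.1 x (spt_iff.2 hx'), hv1.2 x hx', ?_⟩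
      intro i hi
      have := hv2 i (lt_of_le_of_lt (hn i hi) hl)
      rw [hev _ _ (by have := hn i hi; omega)] at this
      exact this
    refine ⟨v, ?_, ?_⟩
    · intro x hx S hS
      obtain ⟨v', h1, h2, h3⟩ := key x (spt_iff.1 hx)
      rw [one_mul] at h1
      have h4 := hcoord x (spt_iff.1 hx) _ (norm_nonneg _) h1
      have h5 := perturb v' v x _ _ (by positivity) (by norm_num) h4 h3
      have h6 := norm_sub_norm_le (LC v' x) (LC v x)
      have h7 := h1 S hS
      linarith
    · intro x hx B hB hxB
      obtain ⟨v', h1, h2, h3⟩ := key x hx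
      have h4 := hcoord x hx B hB hxB
      have h5 := perturb v' v x _ _ (by positivity) (by norm_num) h4 h3
      have h6 := norm_sub_norm_le (LC v x) (LC v' x)
      rw [norm_sub_rev] at h6
      have h7 := h2 B hB hxB
      linarith

end ElC


namespace ElC

open Filter Topology

theorem far_vector {X : Type*} [NormedAddCommGroup X] [NormedSpace ℝ X]
    (W F : Submodule ℝ X) (hW : ¬ FiniteDimensional ℝ W) [FiniteDimensional ℝ F] :
    ∃ w ∈ W, ‖w‖ ≤ 3 ∧ ∀ f ∈ F, 1/4 ≤ ‖w - f‖ := by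
  obtain ⟨w, hw1, hw2⟩ := exists_seq_norm_le_one_le_norm_sub' (𝕜 := ℝ) (E := W) (c := 2) (R := 3)
    (by norm_num) (by norm_num) hW
  by_contra hcon
  push Not at hcon
  have h1 : ∀ m, ∃ f : F, ‖(w m : X) - f‖ < 1/4 := by
    intro m
    obtain ⟨f, hf, hf2⟩ := hcon (w m) (w m).2 (hw1 m)
    exact ⟨⟨f, hf⟩, hf2⟩
  choose f hf using h1
  have hb : ∀ m, f m ∈ Metric.closedBall (0:F) 4 := by
    intro m
    rw [mem_closedBall_zero_iff]
    have h2 : ‖(f m : X)‖ ≤ ‖(w m : X)‖ + ‖(w m : X) - f m‖ := by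
      have := norm_sub_le (w m : X) ((w m : X) - f m)
      simpa using this
    have h3 : ‖(w m : X)‖ ≤ 3 := hw1 m
    have := hf m
    change ‖(f m : X)‖ ≤ 4
    linarith
  obtain ⟨a, _, φ, hφ, hlim⟩ := (isCompact_closedBall (0:F) 4).tendsto_subseq hb
  have hc := hlim.cauchySeq
  rw [Metric.cauchySeq_iff'] at hc
  obtain ⟨N, hN⟩ := hc (1/4) (by norm_num)
  have h4 := hN (N+1) (by omega)
  have h5 := hw2 (show φ (N+1) ≠ φ N from (hφ (by omega)).ne')
  have h5 : 1 ≤ ‖(w (φ (N+1)) : X) - w (φ N)‖ := h5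
  have h6 := hf (φ (N+1))
  have h7 := hf (φ N)
  rw [dist_eq_norm] at h4
  have h4 : ‖(f (φ (N+1)) : X) - f (φ N)‖ < 1/4 := h4
  have h8 : (w (φ (N+1)) : X) - w (φ N) = ((w (φ (N+1)) : X) - f (φ (N+1))) +
    ((f (φ (N+1)) : X) - f (φ N)) - ((w (φ N) : X) - f (φ N)) := by abel
  rw [h8] at h5
  have h9 := norm_sub_le (((w (φ (N+1)) : X) - f (φ (N+1))) +
    ((f (φ (N+1)) : X) - f (φ N))) ((w (φ N) : X) - f (φ N))
  have h10 := norm_add_le ((w (φ (N+1)) : X) - f (φ (N+1))) ((f (φ (N+1)) : X) - f (φ N))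
  linarith

theorem LC_apply {ι X : Type*} [NormedAddCommGroup X] [NormedSpace ℝ X] (e : ι → X)
    (g : X →L[ℝ] ℝ) (x : ι →₀ ℝ) : g (LC e x) = ∑ i ∈ x.support, x i * g (e i) := by
  unfold LC
  rw [Finsupp.linearCombination_apply, Finsupp.sum]
  simp

theorem biorth {X : Type*} [NormedAddCommGroup X] [NormedSpace ℝ X]
    (hX : ¬ FiniteDimensional ℝ X) :
    ∃ (u : ℕ → X) (g : ℕ → X →L[ℝ] ℝ), (∀ a, ‖u a‖ ≤ 3) ∧ (∀ a, ‖g a‖ ≤ 4) ∧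
      ∀ a b, g a (u b) = if a = b then 1 else 0 := by
  let Q : ℕ → (ℕ → X × (X →L[ℝ] ℝ)) → X × (X →L[ℝ] ℝ) → Prop := fun n f z =>
    ‖z.1‖ ≤ 3 ∧ ‖z.2‖ ≤ 4 ∧ z.2 z.1 = 1 ∧ ∀ k < n, z.2 (f k).1 = 0 ∧ (f k).2 z.1 = 0
  have hQ : ∃ f : ℕ → X × (X →L[ℝ] ℝ), ∀ n, Q n f (f n) := by
    have : Inhabited (X × (X →L[ℝ] ℝ)) := ⟨0⟩
    apply seq_choice
    · rintro n f g z hfg ⟨h1, h2, h3, h4⟩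
      refine ⟨h1, h2, h3, fun k hk => ?_⟩
      rw [← hfg k hk]
      exact h4 k hk
    · intro n f _
      let π : X →ₗ[ℝ] (Fin n → ℝ) := LinearMap.pi (fun k => ((f k).2 : X →ₗ[ℝ] ℝ))
      have hW : ¬ FiniteDimensional ℝ (LinearMap.ker π) := by
        intro hfin
        apply hX
        have h1 : FiniteDimensional ℝ (X ⧸ LinearMap.ker π) :=
          Module.Finite.equiv (π.quotKerEquivRange.symm)
        exact Module.Finite.of_submodule_quotient (LinearMap.ker π)
      let F : Submodule ℝ X := Submodule.span ℝ (Set.range (fun k : Fin n => (f k).1))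
      have : FiniteDimensional ℝ F := FiniteDimensional.span_of_finite ℝ (Set.finite_range _)
      obtain ⟨w, hw, hw3, hwF⟩ := far_vector (LinearMap.ker π) F hW
      let E : (ℝ × F) →ₗ[ℝ] X := (LinearMap.toSpanSingleton ℝ X w).coprod F.subtype
      obtain ⟨g, hg4, hg⟩ := hb E (LinearMap.fst ℝ ℝ F) 4 (by norm_num) (by
        rintro ⟨t, y⟩
        simp only [LinearMap.fst_apply, E, LinearMap.coprod_apply,
          LinearMap.toSpanSingleton_apply, Submodule.subtype_apply]
        by_cases ht : t = 0
        · subst ht; simp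
        have h1 := hwF (-(t⁻¹ • (y:X))) (F.neg_mem (F.smul_mem _ y.2))
        have h2 : t • w + (y : X) = t • (w - -(t⁻¹ • (y:X))) := by
          rw [smul_sub, smul_neg, smul_smul, mul_inv_cancel₀ ht]; simp
        rw [h2, norm_smul, Real.norm_eq_abs]
        nlinarith [abs_nonneg t])
      refine ⟨(w, g), hw3, hg4, ?_, ?_⟩
      · have := hg (1, 0)
        simpa [E] using this
      · intro k hk
        constructor
        · have := hg (0, ⟨(f k).1, Submodule.subset_span ⟨⟨k, hk⟩, rfl⟩⟩)
          simpa [E] using this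
        · have h1 : π w = 0 := hw
          have := congrFun h1 ⟨k, hk⟩
          simpa [π] using this
  obtain ⟨f, hf⟩ := hQ
  refine ⟨fun n => (f n).1, fun n => (f n).2, fun n => (hf n).1, fun n => (hf n).2.1, ?_⟩
  intro a b
  rcases lt_trichotomy a b with h | h | h
  · rw [if_neg h.ne]; exact ((hf b).2.2.2 a h).2
  · subst h; rw [if_pos rfl]; exact (hf a).2.2.1
  · rw [if_neg h.ne']; exact ((hf a).2.2.2 b h).1

end ElC


namespace ElC

open Filter Topology

/-! ### Approximate biorthogonality -/

theorem approx_ind {ι X : Type*} [Encodable ι] [NormedAddCommGroup X] [NormedSpace ℝ X]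
    (e : ι → X) (f : X →L[ℝ] ℝ) (A : Set ι) (x : ι →₀ ℝ) (b δ : ℝ) (hb : 0 ≤ b) (hδ : 0 ≤ δ)
    (hx : ∀ i, |x i| ≤ b)
    (h : ∀ i, x i ≠ 0 → |f (e i) - A.indicator (fun _ => (1:ℝ)) i|
      ≤ δ * (1/2 : ℝ) ^ (Encodable.encode i)) :
    |ind A x - f (LC e x)| ≤ 2 * b * δ := by
  have h1 := perturb (fun i => f (e i)) (A.indicator (fun _ => (1:ℝ))) x b δ hb hδ hx h
  have h2 : LC (fun i => f (e i)) x = f (LC e x) := by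
    rw [LC_apply]
    unfold LC
    rw [Finsupp.linearCombination_apply, Finsupp.sum]
    simp
  rw [h2] at h1
  rw [abs_sub_comm]
  exact h1

theorem exists_max {ι : Type*} (x : ι →₀ ℝ) (hx : x ≠ 0) : ∃ j, x j ≠ 0 ∧ ∀ i, |x i| ≤ |x j| := by
  obtain ⟨j, hj, hj2⟩ := x.support.exists_max_image (fun i => |x i|)
    (Finsupp.support_nonempty_iff.2 hx)
  refine ⟨j, Finsupp.mem_support_iff.1 hj, fun i => ?_⟩
  by_cases hi : x i = 0
  · rw [hi]; simp
  · exact hj2 i (Finsupp.mem_support_iff.2 hi)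

def sing (ι : Type*) : Set (Set ι) := Set.range (fun i => ({i} : Set ι))

theorem forall_sing {ι : Type*} {P : Set ι → Prop} : (∀ S ∈ sing ι, P S) ↔ ∀ i, P {i} := by
  simp [sing]

theorem near_biorth {ι X : Type*} [Encodable ι] [NormedAddCommGroup X] [NormedSpace ℝ X]
    (e : ι → X) (f : ι → X →L[ℝ] ℝ) (J : Set ι) (F : ℝ) (hF : ∀ j ∈ J, ‖f j‖ ≤ F)
    (h : ∀ i ∈ J, ∀ j ∈ J, |f j (e i) - ({j} : Set ι).indicator (fun _ => (1:ℝ)) i|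
      ≤ 1/4 * (1/2 : ℝ) ^ (Encodable.encode i)) :
    Lower e J (sing ι) (2 * F) := by
  intro x hx
  rw [spt_iff] at hx
  rw [forall_sing]
  intro i
  rw [ind_singleton]
  by_cases hx0 : x = 0
  · rw [hx0]; simp
  obtain ⟨j, hj, hj2⟩ := exists_max x hx0
  refine (hj2 i).trans ?_
  have h1 := approx_ind e (f j) {j} x |x j| (1/4) (abs_nonneg _) (by norm_num) hj2
    (fun i hi => h i (hx i hi) j (hx j hj))
  rw [ind_singleton] at h1
  have h2 := (f j).le_of_opNorm_le (hF j (hx j hj)) (LC e x)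
  rw [Real.norm_eq_abs] at h2
  have h3 := abs_sub_abs_le_abs_sub (x j) ((f j) (LC e x))
  linarith

/-! ### Transfers for coordinates -/

theorem mapDomain_spt {ι ι' : Type*} {k : ι → ι'} {J : Set ι} {I : Set ι'} (h : Set.MapsTo k J I)
    {x : ι →₀ ℝ} (hx : x ∈ spt J) : Finsupp.mapDomain k x ∈ spt I := by
  classical
  intro i hi
  have := Finsupp.mapDomain_support (Finsupp.mem_support_iff.2 hi)
  obtain ⟨j, hj, rfl⟩ := Finset.mem_image.1 this
  exact h (hx j (Finsupp.mem_support_iff.1 hj))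

theorem mapDomain_apply_injOn {ι ι' : Type*} {k : ι → ι'} {J : Set ι} (h : Set.InjOn k J)
    {x : ι →₀ ℝ} (hx : x ∈ spt J) {i : ι} (hi : i ∈ J) : Finsupp.mapDomain k x (k i) = x i := by
  rw [← ind_singleton, ind_mapDomain, ← ind_singleton i]
  apply ind_congr
  intro l hl
  simp only [Set.mem_preimage, Set.mem_singleton_iff]
  exact ⟨fun h' => h (hx l hl) hi h', fun h' => by rw [h']⟩

theorem mapDomain_abs_le {ι ι' : Type*} {k : ι → ι'} {J : Set ι} (h : Set.InjOn k J)
    {x : ι →₀ ℝ} (hx : x ∈ spt J) {B : ℝ} (hB : 0 ≤ B) (hxB : ∀ i, |x i| ≤ B) (l : ι') :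
    |Finsupp.mapDomain k x l| ≤ B := by
  classical
  by_cases hl : Finsupp.mapDomain k x l = 0
  · rw [hl]; simpa using hB
  have := Finsupp.mapDomain_support (Finsupp.mem_support_iff.2 hl)
  obtain ⟨j, hj, rfl⟩ := Finset.mem_image.1 this
  rw [mapDomain_apply_injOn h hx (hx j (Finsupp.mem_support_iff.1 hj))]
  exact hxB j

theorem Lower.transfer_sing {ι ι' X : Type*} [NormedAddCommGroup X] [NormedSpace ℝ X]
    {e' : ι' → X} {I' : Set ι'} {M : ℝ} (hl : Lower e' I' (sing ι') M) (hM : 0 ≤ M)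
    {k : ι → ι'} {J : Set ι} (h : Set.InjOn k J) (hm : Set.MapsTo k J I') :
    Lower (e' ∘ k) J (sing ι) M := by
  intro x hx
  rw [spt_iff] at hx
  rw [forall_sing]
  intro i
  rw [ind_singleton, ← LC_mapDomain]
  by_cases hi : x i = 0
  · rw [hi, abs_zero]; positivity
  have hi := hx i hi
  have h1 := hl _ (spt_iff.2 (mapDomain_spt hm hx)) {k i} ⟨_, rfl⟩
  rwa [ind_singleton, mapDomain_apply_injOn h hx hi] at h1

theorem Upper.transfer_sing {ι ι' X : Type*} [NormedAddCommGroup X] [NormedSpace ℝ X]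
    {e' : ι' → X} {V' : Set (ι' →₀ ℝ)} {C : ℝ} (hu : Upper e' V' (sing ι') C)
    {k : ι → ι'} {x : ι →₀ ℝ} {J : Set ι} (h : Set.InjOn k J) (hx : x ∈ spt J)
    (hx' : Finsupp.mapDomain k x ∈ V') {B : ℝ} (hB : 0 ≤ B) (hxB : ∀ i, |x i| ≤ B) :
    ‖LC (e' ∘ k) x‖ ≤ C * B := by
  rw [← LC_mapDomain]
  apply hu _ hx' B hB
  rw [forall_sing]
  intro l
  rw [ind_singleton]
  exact mapDomain_abs_le h hx hB hxB l

/-! ### Pruning maps on lists -/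

structure Rho (ρ : List ℕ → List ℕ) : Prop where
  nil : ρ [] = []
  cons : ∀ a r, ∃ m, a ≤ m ∧ ρ (a :: r) = m :: ρ r

theorem Rho.length {ρ : List ℕ → List ℕ} (h : Rho ρ) (l : List ℕ) : (ρ l).length = l.length := by
  induction l with
  | nil => rw [h.nil]
  | cons a r ih =>
    obtain ⟨m, _, hm⟩ := h.cons a r
    rw [hm, List.length_cons, List.length_cons, ih]

theorem Rho.forall2 {ρ : List ℕ → List ℕ} (h : Rho ρ) (l : List ℕ) :
    List.Forall₂ (· ≤ ·) l (ρ l) := by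
  induction l with
  | nil => rw [h.nil]; exact List.Forall₂.nil
  | cons a r ih =>
    obtain ⟨m, hm1, hm⟩ := h.cons a r
    rw [hm]; exact List.Forall₂.cons hm1 ih

theorem Rho.mem {ρ : List ℕ → List ℕ} (h : Rho ρ) {R : Set (List ℕ)} (hR : UC R) {l : List ℕ}
    (hl : l ∈ R) : ρ l ∈ R := hR _ _ hl (h.forall2 l)

theorem Rho.suffix {ρ : List ℕ → List ℕ} (h : Rho ρ) {s l : List ℕ} (hs : s <:+ l) :
    ρ s <:+ ρ l := by
  obtain ⟨t, rfl⟩ := hs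
  induction t with
  | nil => exact List.suffix_rfl
  | cons a r ih =>
    obtain ⟨m, _, hm⟩ := h.cons a (r ++ s)
    rw [List.cons_append, hm]; exact ih.trans (List.suffix_cons _ _)

theorem Rho.suf {ρ : List ℕ → List ℕ} (h : Rho ρ) (j : ℕ) (l : List ℕ) :
    ρ (suf j l) = suf j (ρ l) := by
  have h1 := suf_eq (h.suffix (suf_suffix j l))
  rw [← h1, h.length, length_suf]
  by_cases hj : j ≤ l.length
  · rw [min_eq_left hj]
  · rw [min_eq_right (by omega), suf_self (by rw [h.length]), suf_self (by rw [h.length]; omega)]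

theorem encode_pair_tail (i a : ℕ) (r : List ℕ) :
    Encodable.encode (i, r) < Encodable.encode (i, a :: r) := by
  rw [Encodable.encode_prod_val, Encodable.encode_prod_val]
  apply Nat.pair_lt_pair_right
  rw [Encodable.encode_list_cons]
  have := Nat.right_le_pair (Encodable.encode a) (Encodable.encode r)
  omega

theorem encode_tail (a : ℕ) (r : List ℕ) :
    Encodable.encode r < Encodable.encode (a :: r) := by
  rw [Encodable.encode_list_cons]
  have := Nat.right_le_pair (Encodable.encode a) (Encodable.encode r)
  omega

theorem tend_le {a : ℕ → ℝ} {y ε : ℝ} (h : Tendsto a (hyperfilter ℕ) (𝓝 y)) (hε : 0 < ε) :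
    ∀ᶠ m in (hyperfilter ℕ : Filter ℕ), |a m - y| ≤ ε := by
  have := Metric.tendsto_nhds.1 h ε hε
  filter_upwards [this] with m hm
  rw [Real.dist_eq] at hm
  exact hm.le

theorem hyper_ge (a : ℕ) : ∀ᶠ m in (hyperfilter ℕ : Filter ℕ), a ≤ m :=
  Nat.hyperfilter_le_atTop (eventually_ge_atTop a)

theorem hyper_ne (a : ℕ) : ∀ᶠ m in (hyperfilter ℕ : Filter ℕ), m ≠ a := by
  filter_upwards [hyper_ge (a+1)] with m hm
  omega

def rhoF (f : ℕ → ℕ × ℕ) (i : ℕ) : List ℕ → List ℕ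
  | [] => []
  | a :: r => (f (Encodable.encode (i, a :: r))).1 :: rhoF f i r

theorem rhoF_congr {f g : ℕ → ℕ × ℕ} {i : ℕ} {l : List ℕ}
    (h : ∀ k ≤ Encodable.encode (i, l), f k = g k) : rhoF f i l = rhoF g i l := by
  induction l with
  | nil => rfl
  | cons a r ih =>
    simp only [rhoF]
    rw [h _ le_rfl, ih (fun k hk => h k (hk.trans (encode_pair_tail i a r).le))]

theorem l1prune {X : Type*} [NormedAddCommGroup X] [NormedSpace ℝ X]
    (e : ℕ → List ℕ → X) (C : ℕ → ℝ) (he : ∀ i l, ‖e i l‖ ≤ C i)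
    (φ : ℕ → List ℕ → X →L[ℝ] ℝ) (M : ℝ) (hM : 0 ≤ M) (hφ : ∀ i l, ‖φ i l‖ ≤ M) :
    ∃ (ρ ρ' : ℕ → List ℕ → List ℕ) (ψ : ℕ → List ℕ → X →L[ℝ] ℝ),
      (∀ i, Rho (ρ i)) ∧
      (∀ i a r, ∃ m m', m ≠ m' ∧ ρ i (a :: r) = m :: ρ i r ∧ ρ' i (a :: r) = m' :: ρ i r) ∧
      (∀ i s, ‖ψ i s‖ ≤ M) ∧
      (∀ i s w, Tendsto (fun m => φ i (m :: s) w) (hyperfilter ℕ) (𝓝 (ψ i s w))) ∧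
      ∀ i a r i' a' r', (i, a :: r) ≠ (i', a' :: r') →
        |(φ i (ρ i (a :: r)) - ψ i (ρ i r)) (e i' (ρ i' (a' :: r')) - e i' (ρ' i' (a' :: r')))|
          ≤ 1/4 * (1/2 : ℝ) ^ (Encodable.encode (i', a' :: r')) := by
  choose ψ hψ1 hψ2 using fun (i : ℕ) (s : List ℕ) =>
    weak_lim (fun m => φ i (m :: s)) M hM (fun m => hφ i _)
  -- functional and vector attached to a node
  let fn : ℕ → List ℕ → ℕ × ℕ → (X →L[ℝ] ℝ) := fun i s z => φ i (z.1 :: s) - ψ i s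
  let vc : ℕ → List ℕ → ℕ × ℕ → X := fun i s z => e i (z.1 :: s) - e i (z.2 :: s)
  let Q : ℕ → (ℕ → ℕ × ℕ) → ℕ × ℕ → Prop := fun n f z =>
    ∀ i a r, Encodable.encode (i, a :: r) = n → a ≤ z.1 ∧ z.1 ≠ z.2 ∧
      ∀ i' a' r', Encodable.encode (i', a' :: r') < n →
        |fn i' (rhoF f i' r') (f (Encodable.encode (i', a' :: r'))) (vc i (rhoF f i r) z)|
          ≤ 1/4 * (1/2 : ℝ) ^ n ∧
        |fn i (rhoF f i r) z (vc i' (rhoF f i' r') (f (Encodable.encode (i', a' :: r'))))|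
          ≤ 1/4 * (1/2 : ℝ) ^ n
  obtain ⟨f, hf⟩ : ∃ f, ∀ n, Q n f (f n) := by
    apply seq_choice
    · intro n f g z hfg hQ i a r hn
      obtain ⟨h1, h2, h3⟩ := hQ i a r hn
      refine ⟨h1, h2, fun i' a' r' hn' => ?_⟩
      have h4 := h3 i' a' r' hn'
      have e1 : rhoF f i r = rhoF g i r := rhoF_congr (fun k hk => hfg k
        (lt_of_le_of_lt hk (hn ▸ encode_pair_tail i a r)))
      have e2 : rhoF f i' r' = rhoF g i' r' := rhoF_congr (fun k hk => hfg k
        (lt_of_le_of_lt hk ((encode_pair_tail i' a' r').trans hn')))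
      rw [← e1, ← e2, ← hfg _ hn']
      exact h4
    · intro n f _
      by_cases hn : ∃ (i a : ℕ) (r : List ℕ), Encodable.encode (i, a :: r) = n
      swap
      · exact ⟨(0, 0), fun i a r h => absurd ⟨i, a, r, h⟩ hn⟩
      obtain ⟨i, a, r, hn⟩ := hn
      have hε : 0 < 1/4 * (1/2 : ℝ) ^ n := by positivity
      set ε := 1/4 * (1/2 : ℝ) ^ n with hεd
      set s := rhoF f i r with hs
      -- limits of functionals along the sequence
      have hlim : ∀ h : X →L[ℝ] ℝ, ∃ y, Tendsto (fun m => h (e i (m :: s))) (hyperfilter ℕ) (𝓝 y) := by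
        intro h
        apply lim_exists _ (‖h‖ * C i)
        intro m
        exact (h.le_opNorm _).trans (by gcongr; exact he _ _)
      choose L hL using hlim
      have hfin : {q : ℕ × List ℕ | Encodable.encode q < n}.Finite :=
        (Set.finite_lt_nat n).preimage Encodable.encode_injective.injOn
      let G : ℕ × List ℕ → X →L[ℝ] ℝ := fun q =>
        fn q.1 (rhoF f q.1 q.2.tail) (f (Encodable.encode q))
      let W : ℕ × List ℕ → X := fun q =>
        vc q.1 (rhoF f q.1 q.2.tail) (f (Encodable.encode q))
      have hev : ∀ᶠ m in (hyperfilter ℕ : Filter ℕ), ∀ q ∈ {q : ℕ × List ℕ | Encodable.encode q < n},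
          |G q (e i (m :: s)) - L (G q)| ≤ ε / 2 ∧ |φ i (m :: s) (W q) - ψ i s (W q)| ≤ ε := by
        rw [eventually_all_finite hfin]
        intro q _
        exact (tend_le (hL (G q)) (by positivity)).and (tend_le (hψ2 i s (W q)) hε)
      obtain ⟨m, hm1, hm2⟩ := (hev.and (hyper_ge a)).exists
      obtain ⟨m', hm1', hm2'⟩ := (hev.and (hyper_ne m)).exists
      refine ⟨(m, m'), ?_⟩
      intro i₁ a₁ r₁ h₁
      have := Encodable.encode_injective (h₁.trans hn.symm)
      simp only [Prod.mk.injEq, List.cons.injEq] at this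
      obtain ⟨rfl, rfl, rfl⟩ := this
      refine ⟨hm2, hm2'.symm, ?_⟩
      intro i' a' r' hq
      have h3 := hm1 (i', a' :: r') hq
      have h4 := hm1' (i', a' :: r') hq
      constructor
      · change |G (i', a' :: r') (e i₁ (m :: s) - e i₁ (m' :: s))| ≤ ε
        rw [map_sub]
        have := abs_sub_le (G (i', a' :: r') (e i₁ (m :: s))) (L (G (i', a' :: r')))
          (G (i', a' :: r') (e i₁ (m' :: s)))
        rw [abs_sub_comm (L _)] at this
        linarith [h3.1, h4.1]
      · exact h3.2
  refine ⟨rhoF f, fun i l => match l with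
    | [] => []
    | a :: r => (f (Encodable.encode (i, a :: r))).2 :: rhoF f i r, ψ, ?_, ?_, hψ1, hψ2, ?_⟩
  · intro i
    refine ⟨rfl, fun a r => ⟨_, (hf _ i a r rfl).1, rfl⟩⟩
  · intro i a r
    exact ⟨_, _, (hf _ i a r rfl).2.1, rfl, rfl⟩
  · intro i a r i' a' r' hne
    rcases lt_trichotomy (Encodable.encode (i, a :: r)) (Encodable.encode (i', a' :: r')) with h | h | h
    · exact ((hf _ i' a' r' rfl).2.2 i a r h).1
    · exact absurd (Encodable.encode_injective h) hne
    · refine ((hf _ i a r rfl).2.2 i' a' r' h).2.trans ?_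
      gcongr 1/4 * ?_
      exact pow_le_pow_of_le_one (by norm_num) (by norm_num) h.le

end ElC


namespace ElC

open Filter Topology

theorem Lower.hb {ι X : Type*} [NormedAddCommGroup X] [NormedSpace ℝ X] {e : ι → X}
    {I : Set ι} {A : Set (Set ι)} {M : ℝ} (h : Lower e I A M) (hM : 0 ≤ M) {S : Set ι}
    (hS : S ∈ A) : ∃ f : X →L[ℝ] ℝ, ‖f‖ ≤ M ∧ ∀ x ∈ Finsupp.supported ℝ ℝ I,
        f (LC e x) = ind S x := by
  have hh : ∀ x : Finsupp.supported ℝ ℝ I, |(ind S).domRestrict (Finsupp.supported ℝ ℝ I) x|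
        ≤ M * ‖(LC e).domRestrict (Finsupp.supported ℝ ℝ I) x‖ :=
    fun x => h x.1 x.2 S hS
  obtain ⟨f, hf1, hf2⟩ := ElC.hb (V := Finsupp.supported ℝ ℝ I) _ _ M hM hh
  exact ⟨f, hf1, fun x hx => hf2 ⟨x, hx⟩⟩

theorem l1combine {X : Type*} [NormedAddCommGroup X] [NormedSpace ℝ X]
    (T : ℕ → Set (List ℕ)) (hT : ∀ i, UC (T i))
    (e : ℕ → List ℕ → X) (C : ℕ → ℝ) (he : ∀ i l, ‖e i l‖ ≤ C i)
    (φ : ℕ → List ℕ → X →L[ℝ] ℝ) (M : ℝ) (hM : 0 ≤ M) (hφ : ∀ i l, ‖φ i l‖ ≤ M)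
    (hbi : ∀ i, ∀ r ∈ T i, ∀ r' ∈ T i, ∀ a a',
      φ i (a :: r) (e i (a' :: r')) = if a :: r = a' :: r' then 1 else 0) :
    ∃ (ρ ρ' : ℕ → List ℕ → List ℕ),
      (∀ i, Rho (ρ i)) ∧
      (∀ i a r, ∃ m m', m ≠ m' ∧ ρ i (a :: r) = m :: ρ i r ∧ ρ' i (a :: r) = m' :: ρ i r) ∧
      Lower (fun p : ℕ × List ℕ => e p.1 (ρ p.1 p.2) - e p.1 (ρ' p.1 p.2))
        {p | ∃ a r, p.2 = a :: r ∧ r ∈ T p.1} (sing _) (4 * M) := by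
  obtain ⟨ρ, ρ', ψ, h1, h2, h3, h4, h5⟩ := l1prune e C he φ M hM hφ
  refine ⟨ρ, ρ', h1, h2, ?_⟩
  have hψ : ∀ i, ∀ r ∈ T i, ∀ r' ∈ T i, ∀ a', ψ i r (e i (a' :: r')) = 0 := by
    intro i r hr r' hr' a'
    refine tendsto_nhds_unique (h4 i r (e i (a' :: r'))) ?_
    refine tendsto_const_nhds.congr' ?_
    filter_upwards [hyper_ne a'] with m hm
    rw [hbi i r hr r' hr', if_neg]
    simp [hm]
  have h44 : 4 * M = 2 * (2 * M) := by ring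
  rw [h44]
  apply near_biorth _ (fun p => φ p.1 (ρ p.1 p.2) - ψ p.1 (ρ p.1 p.2.tail))
  · intro p _
    refine (norm_sub_le _ _).trans ?_
    linarith [hφ p.1 (ρ p.1 p.2), h3 p.1 (ρ p.1 p.2.tail)]
  · rintro ⟨i', l'⟩ ⟨a', r', hl', hr'⟩ ⟨i, l⟩ ⟨a, r, hl, hr⟩
    simp only at hl hl' hr hr'
    subst hl hl'
    by_cases hp : (i, a :: r) = (i', a' :: r')
    · simp only [Prod.mk.injEq, List.cons.injEq] at hp
      obtain ⟨rfl, rfl, rfl⟩ := hp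
      obtain ⟨m, m', hmm, hm, hm'⟩ := h2 i a r
      have hρ := (h1 i).mem (hT i) hr
      rw [Set.indicator_of_mem (by simp)]
      simp only [List.tail_cons, hm, hm']
      have e1 : (φ i (m :: ρ i r) - ψ i (ρ i r)) (e i (m :: ρ i r) - e i (m' :: ρ i r)) = 1 := by
        rw [map_sub, _root_.sub_apply, _root_.sub_apply,
          hbi i _ hρ _ hρ, hbi i _ hρ _ hρ, hψ i _ hρ _ hρ, hψ i _ hρ _ hρ, if_pos rfl, if_neg]
        · norm_num
        · simp [hmm]
      rw [e1]
      simp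
    · rw [Set.indicator_of_notMem (by simpa using fun h => Ne.symm hp h), sub_zero]
      exact h5 i a r i' a' r' hp

def I1 (R : Set (List ℕ)) (t : List ℕ) : Set (List ℕ) := {l | ∃ a r, l = a :: r ∧ r ++ t ∈ R}

def V1 (R : Set (List ℕ)) (t : List ℕ) : Set (List ℕ →₀ ℝ) :=
  {x | ∃ r, r ++ t ∈ R ∧ ∃ α : ℕ → ℕ, x ∈ spt {l | ∃ j, j ≤ r.length ∧ l = α j :: suf j r}}

theorem V1_sub {R : Set (List ℕ)} (hR : SC R) (t : List ℕ) : V1 R t ⊆ spt (I1 R t) := by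
  rintro x ⟨r, hr, α, hx⟩
  intro l hl
  obtain ⟨j, hj, rfl⟩ := hx l hl
  exact ⟨_, _, rfl, hR.suffix hr (by
    obtain ⟨q, hq⟩ := suf_suffix j r
    exact ⟨q, by rw [← List.append_assoc, hq]⟩)⟩

/-- reindexing of a tree into blocks by the first letter -/
def kap (l : List ℕ) : ℕ × List ℕ :=
  if l.length ≤ 1 then (0, l) else (l.getLastD 0 + 1, l.dropLast)

theorem kap_one (a : ℕ) : kap [a] = (0, [a]) := by simp [kap]

theorem kap_app (a n : ℕ) (r : List ℕ) : kap (a :: (r ++ [n])) = (n + 1, a :: r) := by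
  have : a :: (r ++ [n]) = (a :: r) ++ [n] := rfl
  rw [this]
  unfold kap
  rw [if_neg (by simp), List.getLastD_concat, List.dropLast_concat]

theorem cons_cases (l : List ℕ) (h : l ≠ []) : (∃ a, l = [a]) ∨ ∃ a r n, l = a :: (r ++ [n]) := by
  match l, h with
  | a :: r, _ =>
    rcases List.eq_nil_or_concat' r with rfl | ⟨r', n, rfl⟩
    · exact Or.inl ⟨a, rfl⟩
    · exact Or.inr ⟨a, r', n, rfl⟩

theorem kap_injOn : Set.InjOn kap {l | l ≠ []} := by
  intro l hl l' hl' h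
  rcases cons_cases l hl with ⟨a, rfl⟩ | ⟨a, r, n, rfl⟩ <;>
  rcases cons_cases l' hl' with ⟨a', rfl⟩ | ⟨a', r', n', rfl⟩ <;>
  simp only [kap_one, kap_app] at h <;> simp_all

theorem suf_app {j : ℕ} {r : List ℕ} {n : ℕ} (hj : j ≤ r.length) :
    suf (j+1) (r ++ [n]) = suf j r ++ [n] := by
  have : suf j r ++ [n] <:+ r ++ [n] := by
    obtain ⟨q, hq⟩ := suf_suffix j r
    exact ⟨q, by rw [← List.append_assoc, hq]⟩
  have h2 := suf_eq this
  rw [List.length_append, length_suf, min_eq_left hj] at h2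
  exact h2

theorem coord_norm {ι X : Type*} [NormedAddCommGroup X] [NormedSpace ℝ X]
    {e : ι → X} {V : Set (ι →₀ ℝ)} {C : ℝ} (hu : Upper e V (sing ι) C) {i : ι}
    (hi : Finsupp.single i 1 ∈ V) : ‖e i‖ ≤ C := by
  classical
  have := hu _ hi 1 zero_le_one (by
    rw [forall_sing]
    intro j
    rw [ind_singleton, Finsupp.single_apply]
    split_ifs <;> simp)
  rwa [LC_single, one_smul, mul_one] at this

theorem LC_sub {ι X : Type*} [NormedAddCommGroup X] [NormedSpace ℝ X] (e e' : ι → X) (x : ι →₀ ℝ) :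
    LC (fun i => e i - e' i) x = LC e x - LC e' x := by
  unfold LC
  simp only [Finsupp.linearCombination_apply, Finsupp.sum, smul_sub, Finset.sum_sub_distrib]

theorem claim1 {X : Type} [NormedAddCommGroup X]
    [NormedSpace ℝ X] [CompleteSpace X] {K : ℝ} (hK : IsKElastic X K) (hK1 : 0 ≤ K)
    (hX : ¬ FiniteDimensional ℝ X) (R : Set (List ℕ)) (hs : SC R) (hu : UC R) (hw : WF R)
    (t : List ℕ) :
    ∃ e : List ℕ → X, Lower e (I1 R t) (sing _) 1 ∧ Upper e (V1 R t) (sing _) K := by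
  classical
  induction t using hw.induction with
  | _ t ih =>
    obtain ⟨u, g, hu3, hg4, hug⟩ := biorth hX
    have ih2 : ∀ n, ∃ e : List ℕ → X,
        Lower e (I1 R (n :: t)) (sing _) 1 ∧ Upper e (V1 R (n :: t)) (sing _) K := by
      intro n
      by_cases hn : n :: t ∈ R
      · exact ih _ ⟨hn, n, rfl⟩
      · have h1 : ∀ r, r ++ n :: t ∉ R := fun r hr => hn (hs.suffix hr (List.suffix_append _ _))
        refine ⟨fun _ => 0, ?_, ?_⟩
        · intro x hx
          have : x = 0 := by
            ext l
            by_contra hl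
            obtain ⟨a, r, _, hr⟩ := spt_iff.1 hx l hl
            exact h1 r hr
          rw [this]; simp
        · rintro x ⟨r, hr, _⟩
          exact absurd hr (h1 r)
    choose E hEl hEu using ih2
    -- coordinate functionals
    have hfun : ∀ n l, ∃ f : X →L[ℝ] ℝ, ‖f‖ ≤ 1 ∧ ∀ x ∈ Finsupp.supported ℝ ℝ (I1 R (n :: t)),
        f (LC (E n) x) = ind {l} x := by
      intro n l
      exact (hEl n).hb zero_le_one ⟨l, rfl⟩
    choose f hf1 hf2 using hfun
    let T : ℕ → Set (List ℕ) := fun i => match i with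
      | 0 => {[]}
      | n + 1 => {r | r ++ n :: t ∈ R}
    let e : ℕ → List ℕ → X := fun i => match i with
      | 0 => fun l => u (l.headD 0)
      | n + 1 => fun l => if l ∈ I1 R (n :: t) then E n l else 0
    let φ : ℕ → List ℕ → X →L[ℝ] ℝ := fun i => match i with
      | 0 => fun l => g (l.headD 0)
      | n + 1 => f n
    have hT : ∀ i, UC (T i) := by
      intro i
      cases i with
      | zero =>
        intro l l' hl h
        have hl : l = [] := hl
        subst hl
        cases h
        rfl
      | succ n =>
        intro l l' hl h
        exact hu _ _ hl (List.rel_append h (List.forall₂_refl _))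
    have he : ∀ i l, ‖e i l‖ ≤ max 3 K := by
      intro i l
      cases i with
      | zero => exact (hu3 _).trans (le_max_left _ _)
      | succ n =>
        change ‖(if l ∈ I1 R (n :: t) then E n l else 0)‖ ≤ _
        split_ifs with hl
        · refine le_trans ?_ (le_max_right _ _)
          apply coord_norm (hEu n)
          obtain ⟨a, r, rfl, hr⟩ := hl
          refine ⟨r, hr, fun _ => a, ?_⟩
          intro l hl
          rw [Finsupp.single_apply_ne_zero] at hl
          refine ⟨r.length, le_rfl, ?_⟩
          rw [suf_self le_rfl]; exact hl.1
        · simp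
    have hφ : ∀ i l, ‖φ i l‖ ≤ 4 := by
      intro i l
      cases i with
      | zero => exact hg4 _
      | succ n => exact (hf1 n l).trans (by norm_num)
    have hbi : ∀ i, ∀ r ∈ T i, ∀ r' ∈ T i, ∀ a a',
        φ i (a :: r) (e i (a' :: r')) = if a :: r = a' :: r' then 1 else 0 := by
      intro i r hr r' hr' a a'
      cases i with
      | zero =>
        have hr : r = [] := hr
        have hr' : r' = [] := hr'
        subst hr hr'
        change g a (u a') = _
        rw [hug]
        simp
      | succ n =>
        have hm : a' :: r' ∈ I1 R (n :: t) := ⟨_, _, rfl, hr'⟩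
        have h1 := hf2 n (a :: r) (Finsupp.single (a' :: r') 1) (by
          rw [spt_iff]
          intro l hl
          rw [Finsupp.single_apply_ne_zero] at hl
          rw [hl.1]; exact hm)
        rw [LC_single, one_smul, ind_singleton, Finsupp.single_apply] at h1
        change f n (a :: r) (if a' :: r' ∈ I1 R (n :: t) then E n (a' :: r') else 0) = _
        rw [if_pos hm, h1]
        simp only [eq_comm]
    obtain ⟨ρ, ρ', hρ, hρρ', hlow⟩ := l1combine T hT e _ he φ 4 (by norm_num) hφ hbi
    set vec : ℕ × List ℕ → X := fun p => e p.1 (ρ p.1 p.2) - e p.1 (ρ' p.1 p.2) with hvec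
    have hvec6 : ∀ p, ‖vec p‖ ≤ 2 * max 3 K := by
      intro p
      refine (norm_sub_le _ _).trans ?_
      linarith [he p.1 (ρ p.1 p.2), he p.1 (ρ' p.1 p.2)]
    have hI_ne : ∀ l ∈ I1 R t, l ≠ [] := by
      rintro _ ⟨a, r, rfl, _⟩
      simp
    have hL : Lower (vec ∘ kap) (I1 R t) (sing _) (4 * 4) := by
      refine hlow.transfer_sing (by norm_num) (fun l hl l' hl' h =>
        kap_injOn (hI_ne l hl) (hI_ne l' hl') h) ?_
      rintro l ⟨a, r, rfl, hr⟩
      rcases List.eq_nil_or_concat' r with rfl | ⟨r', n, rfl⟩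
      · rw [kap_one]
        exact ⟨a, [], rfl, rfl⟩
      · rw [kap_app]
        refine ⟨a, r', rfl, ?_⟩
        change r' ++ n :: t ∈ R
        simpa using hr
    have hU : Upper (vec ∘ kap) (V1 R t) (sing _) (2 * max 3 K + 2 * K) := by
      rintro x ⟨r, hr, α, hx⟩ B hB hxB
      rw [forall_sing] at hxB
      simp only [ind_singleton] at hxB
      -- split off the first element
      set y := x.filter (fun l => l ≠ [α 0]) with hy
      have hxy : x = Finsupp.single [α 0] (x [α 0]) + y := by
        ext l
        rw [Finsupp.add_apply, hy, Finsupp.filter_apply, Finsupp.single_apply]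
        by_cases h : l = [α 0]
        · simp [h]
        · simp [h, Ne.symm h]
      have h1 : ‖LC (vec ∘ kap) x‖ ≤ 2 * max 3 K * B + ‖LC (vec ∘ kap) y‖ := by
        conv_lhs => rw [hxy]
        rw [map_add, LC_single]
        refine (norm_add_le _ _).trans ?_
        gcongr
        rw [norm_smul, mul_comm]
        have := hvec6 (kap [α 0])
        have h3 := hxB [α 0]
        rw [Real.norm_eq_abs]
        simp only [Function.comp_apply]
        gcongr
      have hyB : ∀ l, |y l| ≤ B := by
        intro l
        rw [hy, Finsupp.filter_apply]
        split_ifs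
        · exact hxB l
        · simpa using hB
      rcases List.eq_nil_or_concat' r with rfl | ⟨r', n, rfl⟩
      · have hy0 : y = 0 := by
          ext l
          rw [hy, Finsupp.filter_apply]
          split_ifs with h
          · by_contra hl
            obtain ⟨j, hj, hj2⟩ := hx l hl
            simp only [List.length_nil, nonpos_iff_eq_zero] at hj
            subst hj
            exact h hj2
          · rfl
        rw [hy0] at h1
        simp only [map_zero, norm_zero] at h1
        nlinarith
      · have hr' : r' ++ n :: t ∈ R := by simpa using hr
        set S : Set (List ℕ) := {l | ∃ j, j ≤ r'.length ∧ l = α (j+1) :: (suf j r' ++ [n])} with hS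
        have hyS : y ∈ spt S := by
          intro l hl
          rw [hy, Finsupp.filter_apply] at hl
          split_ifs at hl with h
          · obtain ⟨j, hj, rfl⟩ := hx l hl
            cases j with
            | zero =>
              exfalso; apply h
              simp [suf]
            | succ j =>
              simp only [List.length_append, List.length_singleton] at hj
              exact ⟨j, by omega, by rw [suf_app (by omega)]⟩
          · exact absurd rfl hl
        have hmain : ∀ σ : List ℕ → List ℕ,
            (∀ a s, ∃ m, σ (a :: s) = m :: ρ (n+1) s) →
            ‖LC (fun l => e (n+1) (σ (kap l).2)) y‖ ≤ K * B := by
          intro σ hσ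
          choose m hm using hσ
          let k : List ℕ → List ℕ := fun l => σ (kap l).2
          have hk : ∀ j, k (α (j+1) :: (suf j r' ++ [n]))
              = m (α (j+1)) (suf j r') :: suf j (ρ (n+1) r') := by
            intro j
            simp only [k, kap_app, hm, (hρ (n+1)).suf]
          have hinj : Set.InjOn k S := by
            rintro _ ⟨j, hj, rfl⟩ _ ⟨j', hj', rfl⟩ h
            rw [hk, hk] at h
            have h2 := congrArg List.length h
            simp only [List.length_cons, length_suf, (hρ (n+1)).length] at h2
            have : j = j' := by omega
            rw [this]
          have hmd : Finsupp.mapDomain k y ∈ V1 R (n :: t) := by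
            refine ⟨ρ (n+1) r', (hρ (n+1)).mem (hT (n+1)) hr',
              fun j => m (α (j+1)) (suf j r'), ?_⟩
            refine mapDomain_spt ?_ hyS
            rintro _ ⟨j, hj, rfl⟩
            exact ⟨j, by rw [(hρ (n+1)).length]; exact hj, hk j⟩
          have h5 := (hEu n).transfer_sing hinj hyS hmd hB hyB
          have h6 : LC (fun l => e (n+1) (σ (kap l).2)) y = LC (E n ∘ k) y := by
            rw [← LC_mapDomain]
            have h7 : (fun l => e (n+1) (σ (kap l).2)) = e (n+1) ∘ k := rfl
            rw [h7, ← LC_mapDomain]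
            apply LC_congr
            intro l hl
            have := V1_sub hs _ hmd l hl
            change (if l ∈ I1 R (n :: t) then E n l else 0) = _
            rw [if_pos this]
          rw [h6]; exact h5
        have h8 : LC (vec ∘ kap) y = LC (fun l => e (n+1) (ρ (n+1) (kap l).2)) y -
            LC (fun l => e (n+1) (ρ' (n+1) (kap l).2)) y := by
          rw [← LC_sub]
          apply LC_congr
          intro l hl
          obtain ⟨j, hj, rfl⟩ := hyS l hl
          simp only [Function.comp_apply, hvec, kap_app]
        have h9 := hmain (ρ (n+1)) (fun a s => by
          obtain ⟨m, m', _, h, _⟩ := hρρ' (n+1) a s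
          exact ⟨m, h⟩)
        have h10 := hmain (ρ' (n+1)) (fun a s => by
          obtain ⟨m, m', _, _, h⟩ := hρρ' (n+1) a s
          exact ⟨m', h⟩)
        have h11 := norm_sub_le (LC (fun l => e (n+1) (ρ (n+1) (kap l).2)) y)
          (LC (fun l => e (n+1) (ρ' (n+1) (kap l).2)) y)
        rw [← h8] at h11
        nlinarith
    exact reset_sys hK hK1 _ _ _ _ _ _ (by norm_num) (V1_sub hs t) hL hU

/-- `c₀` embeds -/
theorem lemma1 {X : Type} [NormedAddCommGroup X]
    [NormedSpace ℝ X] [CompleteSpace X] [TopologicalSpace.SeparableSpace X]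
    {K : ℝ} (hK : IsKElastic X K) (hK1 : 0 ≤ K) (hX : ¬ FiniteDimensional ℝ X) :
    ∃ v : ℕ → X, Lower v Set.univ (sing _) 2 ∧ Upper v (spt Set.univ) (sing _) (K + 1) := by
  apply closing _ _ _ hK1
  · intro x _ B hB h i
    rw [forall_sing] at h
    have := h i
    rw [ind_singleton] at this
    linarith
  · intro R hs hw
    obtain ⟨e, hl, hu⟩ := claim1 hK hK1 hX (up R) (up_SC hs) (up_UC R) (up_WF hs hw) []
    refine ⟨fun r => e (0 :: r), fun r hr => ?_⟩
    have hr' : r ∈ up R := subset_up R hr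
    let k : ℕ → List ℕ := fun i => 0 :: suf i r
    set J : Set ℕ := Set.univ ∩ {i | Encodable.encode i < r.length + 1} with hJ
    have hJ2 : ∀ i ∈ J, i ≤ r.length := by
      intro i hi
      have := hi.2
      simp at this
      omega
    have hinj : Set.InjOn k J := by
      intro i hi j hj h
      have h2 := congrArg List.length h
      simp only [k, List.length_cons, length_suf] at h2
      have := hJ2 i hi
      have := hJ2 j hj
      omega
    constructor
    · refine hl.transfer_sing zero_le_one hinj ?_
      intro i hi
      exact ⟨0, suf i r, rfl, by
        rw [List.append_nil]; exact (up_SC hs).suffix hr' (suf_suffix _ _)⟩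
    · intro x hx B hB hxB
      rw [forall_sing] at hxB
      simp only [ind_singleton] at hxB
      refine hu.transfer_sing (k := k) hinj hx ?_ hB hxB
      refine ⟨r, by rwa [List.append_nil], fun _ => 0, mapDomain_spt ?_ hx⟩
      intro i hi
      exact ⟨i, hJ2 i hi, rfl⟩

end ElC


namespace ElC

open Filter Topology

/-! ### Tree systems -/

def br (b : List ℕ) : Set (List ℕ) := {s | s <:+ b}

def TI (T : Set (List ℕ)) : Set (List ℕ) := {s | s ∈ T ∧ s ≠ []}

def TA (T : Set (List ℕ)) : Set (Set (List ℕ)) := {S | ∃ b ∈ T, S = br b}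

def blk {θ : Type*} (i : θ) (b : List ℕ) : Set (θ × List ℕ) := {p | p.1 = i ∧ p.2 <:+ b}

theorem forall_TA {T : Set (List ℕ)} {P : Set (List ℕ) → Prop} :
    (∀ S ∈ TA T, P S) ↔ ∀ b ∈ T, P (br b) := by
  constructor
  · exact fun h b hb => h _ ⟨b, hb, rfl⟩
  · rintro h _ ⟨b, hb, rfl⟩
    exact h b hb

theorem ind_insert {ι : Type*} {A B : Set ι} {i : ι} (hi : i ∉ A) (hB : ∀ j, j ∈ B ↔ j = i ∨ j ∈ A)
    (x : ι →₀ ℝ) : ind B x = x i + ind A x := by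
  classical
  rw [← ind_singleton]
  unfold ind
  simp only [Finsupp.linearCombination_apply, Finsupp.sum, ← Finset.sum_add_distrib, ← smul_add]
  apply Finset.sum_congr rfl
  intro j _
  congr 1
  simp only [Set.indicator_apply, Set.mem_singleton_iff, hB j]
  by_cases h1 : j = i
  · subst h1; simp [hi]
  · simp [h1]

theorem ind_br_cons (a : ℕ) (s : List ℕ) (x : List ℕ →₀ ℝ) :
    ind (br (a :: s)) x = x (a :: s) + ind (br s) x := by
  apply ind_insert
  · intro h
    have := List.IsSuffix.length_le h
    simp at this
  · intro j
    exact List.suffix_cons_iff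

theorem ind_blk_cons {θ : Type*} (i : θ) (a : ℕ) (s : List ℕ) (x : θ × List ℕ →₀ ℝ) :
    ind (blk i (a :: s)) x = x (i, a :: s) + ind (blk i s) x := by
  apply ind_insert
  · intro h
    have := List.IsSuffix.length_le h.2
    simp at this
  · rintro ⟨i', s'⟩
    simp only [blk, Set.mem_setOf_eq, List.suffix_cons_iff, Prod.mk.injEq]
    tauto

theorem TE_norm {X : Type*} [NormedAddCommGroup X] [NormedSpace ℝ X] {T : Set (List ℕ)}
    {e : List ℕ → X} {C : ℝ} (hu : Upper e (spt (TI T)) (TA T) C) {s : List ℕ} (hs : s ∈ TI T) :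
    ‖e s‖ ≤ C := by
  classical
  have := hu (Finsupp.single s 1) (by
    intro l hl
    rw [Finsupp.single_apply_ne_zero] at hl
    rw [hl.1]; exact hs) 1 zero_le_one (by
    rw [forall_TA]
    intro b _
    rw [ind_single, Set.indicator_apply]
    split_ifs <;> simp)
  rwa [LC_single, one_smul, mul_one] at this

theorem weak_null {X : Type*} [NormedAddCommGroup X] [NormedSpace ℝ X] {T : Set (List ℕ)}
    (hT : UC T)
    {e : List ℕ → X} {C : ℝ} (hu : Upper e (spt (TI T)) (TA T) C) {s : List ℕ} {a : ℕ}
    (hs : a :: s ∈ T) (f : X →L[ℝ] ℝ) :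
    Tendsto (fun m => f (e (m :: s))) (hyperfilter ℕ) (𝓝 0) := by
  classical
  have hch : ∀ m, a ≤ m → m :: s ∈ TI T := fun m hm =>
    ⟨hT _ _ hs (List.Forall₂.cons hm (List.forall₂_refl _)), by simp⟩
  have hC : 0 ≤ C := (norm_nonneg _).trans (TE_norm hu (hch a le_rfl))
  obtain ⟨y, hy⟩ : ∃ y, Tendsto (fun m => f (e (m :: s))) (hyperfilter ℕ) (𝓝 y) := by
    obtain ⟨y, hy⟩ := lim_exists (fun m => if a ≤ m then f (e (m :: s)) else 0) (‖f‖ * C) (by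
      intro m
      split_ifs with h
      · exact (f.le_opNorm _).trans (by gcongr; exact TE_norm hu (hch m h))
      · simp only [abs_zero]; positivity)
    refine ⟨y, hy.congr' ?_⟩
    filter_upwards [hyper_ge a] with m hm
    rw [if_pos hm]
  by_cases hy0 : y = 0
  · rwa [hy0] at hy
  exfalso
  have hyp : 0 < |y| := abs_pos.2 hy0
  have hset := (tend_le hy (half_pos hyp)).and (hyper_ge a)
  have hinf : {m | |f (e (m :: s)) - y| ≤ |y| / 2 ∧ a ≤ m}.Infinite := by
    intro hfin
    exact Filter.notMem_hyperfilter_of_finite hfin hset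
  obtain ⟨N, hN⟩ := exists_nat_gt (‖f‖ * C / (|y| / 2))
  obtain ⟨F, hF, hFc⟩ := hinf.exists_subset_card_eq N
  let x : List ℕ →₀ ℝ := ∑ m ∈ F, Finsupp.single (m :: s) 1
  have hx : x ∈ spt (TI T) := by
    rw [← spt_iff]
    apply Submodule.sum_mem
    intro m hm
    rw [spt_iff]
    intro l hl
    rw [Finsupp.single_apply_ne_zero] at hl
    rw [hl.1]; exact hch m (hF hm).2
  have h1 : ‖LC e x‖ ≤ C * 1 := by
    apply hu x hx 1 zero_le_one
    rw [forall_TA]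
    intro b _
    simp only [x, map_sum, ind_single, one_mul]
    by_cases hb : ∃ m ∈ F, (m :: s) <:+ b
    · obtain ⟨m, hm, hmb⟩ := hb
      rw [Finset.sum_eq_single m]
      · rw [Set.indicator_apply]; split_ifs <;> simp
      · intro m' _ hne
        apply Set.indicator_of_notMem
        intro h
        have h2 : (m' :: s) <:+ (m :: s) := List.suffix_of_suffix_length_le h hmb (by simp)
        have := h2.eq_of_length (by simp)
        simp at this
        exact hne this
      · intro h; exact absurd hm h
    · rw [Finset.sum_eq_zero]
      · simp
      · intro m hm
        apply Set.indicator_of_notMem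
        intro h
        exact hb ⟨m, hm, h⟩
  have h2 : f (LC e x) = ∑ m ∈ F, f (e (m :: s)) := by
    simp only [x, map_sum, LC_single, one_smul]
  have h3 : |∑ m ∈ F, (f (e (m :: s)) - y)| ≤ N * (|y| / 2) := by
    refine (Finset.abs_sum_le_sum_abs _ _).trans ?_
    have := Finset.sum_le_card_nsmul F (fun m => |f (e (m :: s)) - y|) (|y|/2)
      (fun m hm => (hF hm).1)
    rwa [hFc, nsmul_eq_mul] at this
  rw [Finset.sum_sub_distrib, ← h2, Finset.sum_const, hFc, nsmul_eq_mul] at h3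
  have h4 : |f (LC e x)| ≤ ‖f‖ * C :=
    (f.le_opNorm _).trans (by gcongr; linarith)
  rw [div_lt_iff₀ (by positivity)] at hN
  have h5 := abs_sub_abs_le_abs_sub ((N:ℝ) * y) (f (LC e x))
  rw [abs_sub_comm, abs_mul, Nat.abs_cast] at h5
  linarith

theorem good_functionals {X : Type*} [NormedAddCommGroup X] [NormedSpace ℝ X] {T : Set (List ℕ)}
    (hSC : SC T) (hUC : UC T) (hw : WF T) {e : List ℕ → X} (hl : Lower e (TI T) (TA T) 1) :
    ∃ φ : List ℕ → X →L[ℝ] ℝ, (∀ b ∈ T, ‖φ b‖ ≤ 2) ∧ φ [] = 0 ∧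
      (∀ b ∈ T, ∀ s ∈ TI T, φ b (e s) = (br b).indicator (fun _ => (1:ℝ)) s) ∧
      ∀ b a, a :: b ∈ T → ∀ w, Tendsto (fun m => φ (m :: b) w) (hyperfilter ℕ) (𝓝 (φ b w)) := by
  classical
  have h0 : ∀ b, ∃ f : X →L[ℝ] ℝ, b ∈ T → (‖f‖ ≤ 1 ∧ ∀ s ∈ TI T,
      f (e s) = (br b).indicator (fun _ => (1:ℝ)) s) := by
    intro b
    by_cases hb : b ∈ T
    · obtain ⟨f, hf1, hf2⟩ := hl.hb zero_le_one ⟨b, hb, rfl⟩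
      refine ⟨f, fun _ => ⟨hf1, fun s hs => ?_⟩⟩
      have := hf2 (Finsupp.single s 1) (by
        rw [spt_iff]
        intro l hl
        rw [Finsupp.single_apply_ne_zero] at hl
        rw [hl.1]; exact hs)
      rwa [LC_single, one_smul, ind_single, one_mul] at this
    · exact ⟨0, fun h => absurd h hb⟩
  choose φ₀ hφ₀ using h0
  have hlim : ∀ f : ℕ → X →L[ℝ] ℝ, ∃ g : X →L[ℝ] ℝ, (∀ m, ‖f m‖ ≤ 1) →
      (‖g‖ ≤ 1 ∧ ∀ w, Tendsto (fun m => f m w) (hyperfilter ℕ) (𝓝 (g w))) := by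
    intro f
    by_cases hf : ∀ m, ‖f m‖ ≤ 1
    · obtain ⟨g, hg⟩ := weak_lim f 1 zero_le_one hf
      exact ⟨g, fun _ => hg⟩
    · exact ⟨0, fun h => absurd h hf⟩
  choose lim hlim using hlim
  let step : ∀ b : List ℕ, (∀ c : List ℕ, (c ∈ T ∧ ∃ a, c = a :: b) → (X →L[ℝ] ℝ)) → (X →L[ℝ] ℝ) :=
    fun b rec => if ∃ a, a :: b ∈ T then
      lim (fun m => if hm : m :: b ∈ T then rec (m :: b) ⟨hm, m, rfl⟩ else 0) else φ₀ b
  let Φ : List ℕ → X →L[ℝ] ℝ := hw.fix step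
  have hΦ : ∀ b, Φ b = if ∃ a, a :: b ∈ T then
      lim (fun m => if m :: b ∈ T then Φ (m :: b) else 0) else φ₀ b := by
    intro b
    have := hw.fix_eq step b
    simp only [Φ]
    rw [this]
    simp only [step, dite_eq_ite]
  have key : ∀ b, b ∈ T → ‖Φ b‖ ≤ 1 ∧ (∀ s ∈ TI T, Φ b (e s) = (br b).indicator (fun _ => (1:ℝ)) s) ∧
      ((∃ a, a :: b ∈ T) →
        ∀ w, Tendsto (fun m => Φ (m :: b) w) (hyperfilter ℕ) (𝓝 (Φ b w))) := by
    intro b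
    induction b using hw.induction with
    | _ b ih =>
      intro hb
      by_cases hch : ∃ a, a :: b ∈ T
      · have hΦb := hΦ b
        rw [if_pos hch] at hΦb
        have h1 := hlim (fun m => if m :: b ∈ T then Φ (m :: b) else 0) (by
          intro m
          split_ifs with hm
          · exact (ih _ ⟨hm, m, rfl⟩ hm).1
          · simp)
        rw [← hΦb] at h1
        obtain ⟨a, ha⟩ := hch
        have hev : ∀ᶠ m in (hyperfilter ℕ : Filter ℕ), m :: b ∈ T := by
          filter_upwards [hyper_ge a] with m hm
          exact hUC _ _ ha (List.Forall₂.cons hm (List.forall₂_refl _))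
        have h2 : ∀ w, Tendsto (fun m => Φ (m :: b) w) (hyperfilter ℕ) (𝓝 (Φ b w)) := by
          intro w
          refine (h1.2 w).congr' ?_
          filter_upwards [hev] with m hm
          rw [if_pos hm]
        refine ⟨h1.1, ?_, fun _ => h2⟩
        intro s hs
        refine tendsto_nhds_unique (h2 (e s)) ?_
        refine tendsto_const_nhds.congr' ?_
        filter_upwards [hev, hyper_ne (s.headD 0)] with m hm hm2
        rw [(ih _ ⟨hm, m, rfl⟩ hm).2.1 s hs]
        simp only [Set.indicator_apply, br, Set.mem_setOf_eq, List.suffix_cons_iff]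
        have : s ≠ m :: b := by
          rintro rfl
          exact hm2 rfl
        simp [this]
      · have hΦb := hΦ b
        rw [if_neg hch] at hΦb
        rw [hΦb]
        exact ⟨(hφ₀ b hb).1, (hφ₀ b hb).2, fun h => absurd h hch⟩
  refine ⟨fun b => Φ b - Φ [], ?_, by simp, ?_, ?_⟩
  · intro b hb
    have hnil : [] ∈ T := hSC.suffix hb List.nil_suffix
    refine (norm_sub_le _ _).trans ?_
    linarith [(key b hb).1, (key [] hnil).1]
  · intro b hb s hs
    have hnil : [] ∈ T := hSC.suffix hb List.nil_suffix
    rw [_root_.sub_apply, (key b hb).2.1 s hs, (key [] hnil).2.1 s hs,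
      Set.indicator_of_notMem (s := br []), sub_zero]
    intro h
    exact hs.2 (List.suffix_nil.1 h)
  · intro b a hab w
    have := (key b (hSC _ _ hab)).2.2 ⟨a, hab⟩ w
    simp only [_root_.sub_apply]
    exact this.sub_const _

end ElC


namespace ElC

open Filter Topology

/-! ### Simultaneous pruning of tree systems -/

theorem zero_apply_clm {X : Type*} [NormedAddCommGroup X] [NormedSpace ℝ X] (w : X) :
    (0 : X →L[ℝ] ℝ) w = 0 := rfl

theorem enc_pt {θ : Type*} [Encodable θ] (i : θ) (a : ℕ) (r : List ℕ) :
    Encodable.encode (i, r) < Encodable.encode (i, a :: r) := by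
  rw [Encodable.encode_prod_val, Encodable.encode_prod_val]
  exact Nat.pair_lt_pair_right _ (encode_tail a r)

def rhoG {θ : Type*} [Encodable θ] (f : ℕ → ℕ) (i : θ) : List ℕ → List ℕ
  | [] => []
  | a :: r => (a + f (Encodable.encode (i, a :: r))) :: rhoG f i r

theorem rhoG_rho {θ : Type*} [Encodable θ] (f : ℕ → ℕ) (i : θ) : Rho (rhoG f i) :=
  ⟨rfl, fun _ _ => ⟨_, Nat.le_add_right _ _, rfl⟩⟩

theorem rhoG_congr {θ : Type*} [Encodable θ] {f g : ℕ → ℕ} {i : θ} {l : List ℕ}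
    (h : ∀ k ≤ Encodable.encode (i, l), f k = g k) : rhoG f i l = rhoG g i l := by
  induction l with
  | nil => rfl
  | cons a r ih =>
    simp only [rhoG]
    rw [h _ le_rfl, ih (fun k hk => h k (hk.trans (enc_pt i a r).le))]

theorem prune {θ : Type*} [Encodable θ] {X : Type*} [NormedAddCommGroup X] [NormedSpace ℝ X]
    (T : θ → Set (List ℕ)) (hSC : ∀ i, SC (T i)) (hUC : ∀ i, UC (T i)) (hWF : ∀ i, WF (T i))
    (e : θ → List ℕ → X) (hl : ∀ i, Lower (e i) (TI (T i)) (TA (T i)) 1)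
    (hu : ∀ i, ∃ C, Upper (e i) (spt (TI (T i))) (TA (T i)) C) :
    ∃ ρ : θ → List ℕ → List ℕ, (∀ i, Rho (ρ i)) ∧ (∀ i, Set.InjOn (ρ i) (T i)) ∧
      Lower (fun p : θ × List ℕ => e p.1 (ρ p.1 p.2)) {p | p.2 ∈ TI (T p.1)}
        {S | ∃ i b, b ∈ T i ∧ S = blk i b} 4 := by
  classical
  choose φ hφ1 hφ0 hφ2 hφ3 using fun i => good_functionals (hSC i) (hUC i) (hWF i) (hl i)
  let ε : ℕ → ℝ := fun n => 1/48 * (1/2 : ℝ) ^ n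
  have hε : ∀ n, 0 < ε n := fun n => by positivity
  have hε2 : ∀ m n, m < n → 2 * ε n ≤ ε m := by
    intro m n hmn
    have : (1/2:ℝ)^n ≤ (1/2)^(m+1) := pow_le_pow_of_le_one (by norm_num) (by norm_num) hmn
    simp only [ε]
    rw [pow_succ] at this
    linarith
  let Q : ℕ → (ℕ → ℕ) → ℕ → Prop := fun n f z =>
    ∀ (i : θ) (a : ℕ) (s : List ℕ), Encodable.encode (i, a :: s) = n → a :: s ∈ T i →
      (∀ a' : ℕ, Encodable.encode (i, a' :: s) < n → a + z ≠ a' + f (Encodable.encode (i, a' :: s))) ∧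
      ∀ (i' : θ) (s' : List ℕ), Encodable.encode (i', s') < n → s' ∈ T i' →
        |φ i' (rhoG f i' s') (e i ((a + z) :: rhoG f i s))| ≤ ε n ∧
        |(φ i ((a + z) :: rhoG f i s) - φ i (rhoG f i s)) (e i' (rhoG f i' s'))| ≤ ε n
  obtain ⟨f, hf⟩ : ∃ f, ∀ n, Q n f (f n) := by
    apply seq_choice
    · intro n f g z hfg hQ i a s hn hs
      obtain ⟨h1, h2⟩ := hQ i a s hn hs
      refine ⟨fun a' h => by rw [← hfg _ h]; exact h1 a' h, fun i' s' hn' hs' => ?_⟩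
      have h4 := h2 i' s' hn' hs'
      have e1 : rhoG f i s = rhoG g i s := rhoG_congr (fun k hk => hfg k
        (lt_of_le_of_lt hk (hn ▸ enc_pt i a s)))
      have e2 : rhoG f i' s' = rhoG g i' s' := rhoG_congr (fun k hk => hfg k
        (lt_of_le_of_lt hk hn'))
      rw [← e1, ← e2]
      exact h4
    · intro n f _
      by_cases hn : ∃ (i : θ) (a : ℕ) (s : List ℕ), Encodable.encode (i, a :: s) = n ∧ a :: s ∈ T i
      swap
      · exact ⟨0, fun i a r h h' => absurd ⟨i, a, r, h, h'⟩ hn⟩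
      obtain ⟨i, a, s, hn, hs⟩ := hn
      obtain ⟨C, hC⟩ := hu i
      have hm : ∃ m, rhoG f i (a :: s) = m :: rhoG f i s := ⟨_, rfl⟩
      obtain ⟨m₀, hm₀⟩ := hm
      have hm₀T : m₀ :: rhoG f i s ∈ T i := hm₀ ▸ (rhoG_rho f i).mem (hUC i) hs
      have hfin : {q : θ × List ℕ | Encodable.encode q < n}.Finite :=
        (Set.finite_lt_nat n).preimage Encodable.encode_injective.injOn
      have hev : ∀ᶠ m in (hyperfilter ℕ : Filter ℕ), ∀ q ∈ {q : θ × List ℕ | Encodable.encode q < n},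
          |φ q.1 (rhoG f q.1 q.2) (e i (m :: rhoG f i s)) - 0| ≤ ε n ∧
          |φ i (m :: rhoG f i s) (e q.1 (rhoG f q.1 q.2)) - φ i (rhoG f i s) (e q.1 (rhoG f q.1 q.2))| ≤ ε n ∧
          m ≠ q.2.headD 0 + f (Encodable.encode q) := by
        rw [eventually_all_finite hfin]
        intro q _
        exact (tend_le (weak_null (hUC i) hC hm₀T _) (hε n)).and
          ((tend_le (hφ3 i _ _ hm₀T _) (hε n)).and (hyper_ne _))
      obtain ⟨m, hm1, hm2⟩ := (hev.and (hyper_ge a)).exists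
      refine ⟨m - a, ?_⟩
      intro i₁ a₁ r₁ h₁ _
      have := Encodable.encode_injective (h₁.trans hn.symm)
      simp only [Prod.mk.injEq, List.cons.injEq] at this
      obtain ⟨rfl, rfl, rfl⟩ := this
      rw [Nat.add_sub_cancel' hm2]
      refine ⟨fun a' h => (hm1 (i₁, a' :: r₁) h).2.2, fun i' s' hq _ => ?_⟩
      have h3 := hm1 (i', s') hq
      refine ⟨by simpa using h3.1, h3.2.1⟩
  have hinj : ∀ i, Set.InjOn (rhoG f i) (T i) := by
    intro i l
    induction l with
    | nil =>
      intro _ l' _ h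
      cases l' with
      | nil => rfl
      | cons a r => simp [rhoG] at h
    | cons a r ih =>
      intro hl l' hl' h
      cases l' with
      | nil => simp [rhoG] at h
      | cons a' r' =>
        simp only [rhoG, List.cons.injEq] at h
        have hr := ih (hSC i _ _ hl) (hSC i _ _ hl') h.2
        subst hr
        rcases lt_trichotomy (Encodable.encode (i, a :: r)) (Encodable.encode (i, a' :: r)) with h1 | h1 | h1
        · exact absurd h.1.symm ((hf _ i a' r rfl hl').1 a h1)
        · have := Encodable.encode_injective h1
          simpa using this
        · exact absurd h.1 ((hf _ i a r rfl hl).1 a' h1)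
  refine ⟨rhoG f, rhoG_rho f, hinj, ?_⟩
  have hcross : ∀ i i', i ≠ i' → ∀ u ∈ TI (T i'), ∀ b, b ∈ T i →
      (Encodable.encode (i, b) < Encodable.encode (i', u) →
        |φ i (rhoG f i b) (e i' (rhoG f i' u))| ≤ ε (Encodable.encode (i', u))) ∧
      (Encodable.encode (i', u) < Encodable.encode (i, b) →
        |φ i (rhoG f i b) (e i' (rhoG f i' u))| ≤
          3 * ε (Encodable.encode (i', u)) - ε (Encodable.encode (i, b))) := by
    intro i i' hne u hu b hb
    constructor
    · intro hlt
      obtain ⟨huT, hu0⟩ := hu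
      cases u with
      | nil => exact absurd rfl hu0
      | cons a' s' => exact ((hf _ i' a' s' rfl huT).2 i b hlt hb).1
    · induction b with
      | nil =>
        intro hlt
        simp only [rhoG, hφ0]
        have := hε2 _ _ hlt
        have := hε (Encodable.encode (i, ([] : List ℕ)))
        rw [zero_apply_clm, abs_zero]
        linarith
      | cons a s ih =>
        intro hlt
        have h2 := ((hf _ i a s rfl hb).2 i' u hlt hu.1).2
        have hsT := hSC i _ _ hb
        have h3 := hε2 _ _ (enc_pt i a s)
        have h4 := hε2 _ _ hlt
        have h6 : φ i (rhoG f i (a :: s)) (e i' (rhoG f i' u)) =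
          (φ i ((a + f (Encodable.encode (i, a :: s))) :: rhoG f i s) - φ i (rhoG f i s)) (e i' (rhoG f i' u)) +
          φ i (rhoG f i s) (e i' (rhoG f i' u)) := by
          simp [rhoG]
        have h7 := abs_add_le ((φ i ((a + f (Encodable.encode (i, a :: s))) :: rhoG f i s) - φ i (rhoG f i s)) (e i' (rhoG f i' u)))
          (φ i (rhoG f i s) (e i' (rhoG f i' u)))
        rw [← h6] at h7
        rcases lt_trichotomy (Encodable.encode (i, s)) (Encodable.encode (i', u)) with h1 | h1 | h1
        · have h5 : |φ i (rhoG f i s) (e i' (rhoG f i' u))| ≤ ε (Encodable.encode (i', u)) := by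
            obtain ⟨huT, hu0⟩ := hu
            cases u with
            | nil => exact absurd rfl hu0
            | cons a' s' => exact ((hf _ i' a' s' rfl huT).2 i s h1 hsT).1
          linarith [hε (Encodable.encode (i', u))]
        · have := Encodable.encode_injective h1
          simp only [Prod.mk.injEq] at this
          exact absurd this.1 hne
        · have h5 := ih hsT h1
          linarith
  have hmemTI : ∀ i s, s ∈ TI (T i) → rhoG f i s ∈ TI (T i) := by
    intro i s hs
    refine ⟨(rhoG_rho f i).mem (hUC i) hs.1, ?_⟩
    intro h
    have := (rhoG_rho f i).length s
    rw [h] at this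
    exact hs.2 (List.length_eq_zero_iff.1 (by simpa using this.symm))
  have happ : ∀ i, ∀ b ∈ T i, ∀ p : θ × List ℕ, p.2 ∈ TI (T p.1) →
      |φ i (rhoG f i b) (e p.1 (rhoG f p.1 p.2)) - (blk i b).indicator (fun _ => (1:ℝ)) p|
        ≤ 1/16 * (1/2 : ℝ) ^ (Encodable.encode p) := by
    rintro i b hb ⟨i', u⟩ hu
    simp only at hu ⊢
    have h316 : 1/16 * (1/2 : ℝ) ^ (Encodable.encode (i', u)) = 3 * ε (Encodable.encode (i', u)) := by
      simp only [ε]; ring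
    by_cases hii : i = i'
    · subst hii
      rw [hφ2 i _ ((rhoG_rho f i).mem (hUC i) hb) _ (hmemTI i u hu)]
      have hiff : rhoG f i u ∈ br (rhoG f i b) ↔ (i, u) ∈ blk i b := by
        constructor
        · intro h
          refine ⟨rfl, ?_⟩
          have h1 : suf (rhoG f i u).length (rhoG f i b) = rhoG f i u := suf_eq h
          rw [(rhoG_rho f i).length, ← (rhoG_rho f i).suf] at h1
          have h2 := hinj i ((hSC i).suffix hb (suf_suffix _ _)) hu.1 h1
          show u <:+ b
          rw [← h2]
          exact suf_suffix _ _
        · intro h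
          exact (rhoG_rho f i).suffix h.2
      simp only [Set.indicator_apply, hiff, sub_self, abs_zero]
      positivity
    · rw [Set.indicator_of_notMem (fun h => hii h.1.symm), sub_zero, h316]
      obtain ⟨h1, h2⟩ := hcross i i' hii u hu b hb
      rcases lt_trichotomy (Encodable.encode (i, b)) (Encodable.encode (i', u)) with h | h | h
      · linarith [h1 h, hε (Encodable.encode (i', u))]
      · have := Encodable.encode_injective h
        simp only [Prod.mk.injEq] at this
        exact absurd this.1 hii
      · linarith [h2 h, hε (Encodable.encode (i, b))]
  rintro x hx _ ⟨i, b, hb, rfl⟩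
  rw [spt_iff] at hx
  by_cases hx0 : x = 0
  · subst hx0; simp
  obtain ⟨p, hp, hmax⟩ := exists_max x hx0
  have hΛ : ∀ i, ∀ b ∈ T i, |ind (blk i b) x| ≤
      2 * ‖LC (fun p : θ × List ℕ => e p.1 (rhoG f p.1 p.2)) x‖ + |x p| / 8 := by
    intro i b hb
    have h1 := approx_ind (fun p : θ × List ℕ => e p.1 (rhoG f p.1 p.2)) (φ i (rhoG f i b)) (blk i b) x
      |x p| (1/16) (abs_nonneg _) (by norm_num) hmax (fun q hq => happ i b hb q (hx q hq))
    have h2 : |φ i (rhoG f i b) (LC (fun p : θ × List ℕ => e p.1 (rhoG f p.1 p.2)) x)| ≤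
        2 * ‖LC (fun p : θ × List ℕ => e p.1 (rhoG f p.1 p.2)) x‖ :=
      (φ i (rhoG f i b)).le_of_opNorm_le (hφ1 i _ ((rhoG_rho f i).mem (hUC i) hb)) _
    have h3 := abs_sub_abs_le_abs_sub (ind (blk i b) x) (φ i (rhoG f i b) (LC (fun p : θ × List ℕ => e p.1 (rhoG f p.1 p.2)) x))
    linarith
  have hp2 := hx p hp
  obtain ⟨j, u⟩ := p
  obtain ⟨huT, hu0⟩ := hp2
  simp only at huT hu0
  cases u with
  | nil => exact absurd rfl hu0
  | cons a s =>
    have h1 := hΛ j _ huT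
    have h2 := hΛ j _ (hSC j _ _ huT)
    have h3 : x (j, a :: s) = ind (blk j (a :: s)) x - ind (blk j s) x := by
      rw [ind_blk_cons]; ring
    have h4 : |x (j, a :: s)| ≤ |ind (blk j (a :: s)) x| + |ind (blk j s) x| := by
      conv_lhs => rw [h3]
      exact abs_sub _ _
    have h5 := hΛ i b hb
    have h6 := norm_nonneg (LC (fun p : θ × List ℕ => e p.1 (rhoG f p.1 p.2)) x)
    linarith

/-- The pull-back of a branch along `ρ` is a branch. -/
theorem rho_max {ρ : List ℕ → List ℕ} (hρ : Rho ρ) {T : Set (List ℕ)} (hSC : SC T)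
    (hinj : Set.InjOn ρ T) (hnil : [] ∈ T) (b : List ℕ) :
    ∃ b' ∈ T, ∀ s ∈ T, ρ s <:+ b ↔ s <:+ b' := by
  induction b with
  | nil =>
    refine ⟨[], hnil, fun s _ => ?_⟩
    rw [List.suffix_nil, List.suffix_nil, ← List.length_eq_zero_iff, hρ.length,
      List.length_eq_zero_iff]
  | cons a b ih =>
    obtain ⟨b', hb', h⟩ := ih
    by_cases hex : ∃ s ∈ T, ρ s = a :: b
    · obtain ⟨s, hs, hsb⟩ := hex
      refine ⟨s, hs, fun t ht => ?_⟩
      rw [← hsb]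
      constructor
      · intro h
        have h1 := suf_eq h
        rw [hρ.length, ← hρ.suf] at h1
        rw [← hinj (hSC.suffix hs (suf_suffix _ _)) ht h1]
        exact suf_suffix _ _
      · exact hρ.suffix
    · refine ⟨b', hb', fun s hs => ?_⟩
      rw [List.suffix_cons_iff, ← h s hs]
      constructor
      · rintro (h1 | h1)
        · exact absurd ⟨s, hs, h1⟩ hex
        · exact h1
      · exact Or.inr

end ElC


namespace ElC

open Filter Topology

/-! ### Sums of tree systems -/

theorem Lower.transfer {ι ι' X : Type*} [NormedAddCommGroup X] [NormedSpace ℝ X]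
    {e' : ι' → X} {I' : Set ι'} {A' : Set (Set ι')} {M : ℝ} (hl : Lower e' I' A' M)
    (k : ι → ι') {x : ι →₀ ℝ} (hx : ∀ i, x i ≠ 0 → k i ∈ I') {S : Set ι} {S' : Set ι'} (hS : S' ∈ A')
    (h : ∀ i, x i ≠ 0 → (i ∈ S ↔ k i ∈ S')) : |ind S x| ≤ M * ‖LC (e' ∘ k) x‖ := by
  have h1 := hl (Finsupp.mapDomain k x) (by
    rw [spt_iff]
    exact mapDomain_spt (J := {i | x i ≠ 0}) hx (fun i hi => hi)) S' hS
  rw [ind_mapDomain, LC_mapDomain] at h1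
  rwa [ind_congr (B := k ⁻¹' S') h]

theorem Upper.transfer {ι ι' X : Type*} [NormedAddCommGroup X] [NormedSpace ℝ X]
    {e' : ι' → X} {V' : Set (ι' →₀ ℝ)} {A' : Set (Set ι')} {C : ℝ} (hu : Upper e' V' A' C)
    (k : ι → ι') {x : ι →₀ ℝ} (hx : Finsupp.mapDomain k x ∈ V') {B : ℝ} (hB : 0 ≤ B)
    (h : ∀ S' ∈ A', ∃ S : Set ι, |ind S x| ≤ B ∧ ∀ i, x i ≠ 0 → (i ∈ S ↔ k i ∈ S')) :
    ‖LC (e' ∘ k) x‖ ≤ C * B := by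
  have h1 := hu (Finsupp.mapDomain k x) hx B hB (by
    intro S' hS'
    obtain ⟨S, hS1, hS2⟩ := h S' hS'
    rw [ind_mapDomain, ← ind_congr (B := k ⁻¹' S') hS2]
    exact hS1)
  rwa [LC_mapDomain] at h1

theorem ind_filter {ι : Type*} (P : ι → Prop) [DecidablePred P] (S : Set ι) (x : ι →₀ ℝ) :
    ind S (x.filter P) = ind (S ∩ {i | P i}) x := by
  classical
  induction x using Finsupp.induction_linear with
  | zero => rw [Finsupp.filter_zero, map_zero, map_zero]
  | add f g hf hg => rw [Finsupp.filter_add, map_add, map_add, hf, hg]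
  | single i c =>
    by_cases h : P i
    · rw [Finsupp.filter_single_of_pos _ h, ind_single, ind_single]
      simp [Set.indicator_apply, h]
    · rw [Finsupp.filter_single_of_neg _ h, ind_single]
      simp [h]

theorem WF.mono {T T' : Set (List ℕ)} (h : WF T) (hs : T' ⊆ T) : WF T' :=
  Subrelation.wf (fun {_ _} hab => ⟨hs hab.1, hab.2⟩) h

def PT (X : Type) [NormedAddCommGroup X] [NormedSpace ℝ X] (K : ℝ) (T : Set (List ℕ)) : Prop :=
  ∃ e : List ℕ → X, Lower e (TI T) (TA T) 1 ∧ Upper e (spt (TI T)) (TA T) K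

def FT (R : Set (List ℕ)) (T : ℕ → Set (List ℕ)) (σ τ : List ℕ) : Set (List ℕ) :=
  {l | τ ++ σ ∈ R ∧ l ∈ T (τ.length + σ.length)}

def BI {θ : Type*} (F : θ → Set (List ℕ)) : Set (θ × List ℕ) := {p | p.2 ∈ TI (F p.1)}
def BA {θ : Type*} (F : θ → Set (List ℕ)) : Set (Set (θ × List ℕ)) :=
  {S | ∃ i b, b ∈ F i ∧ S = blk i b}

def V2 (R : Set (List ℕ)) (T : ℕ → Set (List ℕ)) (σ : List ℕ) : Set (List ℕ × List ℕ →₀ ℝ) :=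
  {x | ∃ τ₀, τ₀ ++ σ ∈ R ∧ x ∈ spt (BI (FT R T σ) ∩ {p | p.1 <:+ τ₀})}

theorem V2_sub (R : Set (List ℕ)) (T : ℕ → Set (List ℕ)) (σ : List ℕ) :
    V2 R T σ ⊆ spt (BI (FT R T σ)) := by
  rintro x ⟨τ₀, _, hx⟩ p hp
  exact (hx p hp).1

theorem FT_app (R : Set (List ℕ)) (T : ℕ → Set (List ℕ)) (σ τ : List ℕ) (n : ℕ) :
    FT R T σ (τ ++ [n]) = FT R T (n :: σ) τ := by
  unfold FT
  ext l
  simp only [Set.mem_ofPred_eq, List.append_assoc, List.cons_append, List.nil_append,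
    List.length_append, List.length_cons, List.length_nil]
  rw [show τ.length + (0 + 1) + σ.length = τ.length + (σ.length + 1) by omega]

theorem claim2 {X : Type} [NormedAddCommGroup X]
    [NormedSpace ℝ X] [CompleteSpace X] {K : ℝ} (hK : IsKElastic X K) (hK1 : 0 ≤ K)
    (T : ℕ → Set (List ℕ)) (hSC : ∀ i, SC (T i)) (hUC : ∀ i, UC (T i)) (hWF : ∀ i, WF (T i))
    (hT : ∀ i, PT X K (T i))
    (R : Set (List ℕ)) (hs : SC R) (hw : WF R)
    (σ : List ℕ) :
    ∃ e : List ℕ × List ℕ → X, Lower e (BI (FT R T σ)) (BA (FT R T σ)) 1 ∧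
      Upper e (V2 R T σ) (BA (FT R T σ)) K := by
  classical
  induction σ using hw.induction with
  | _ σ ih =>
    by_cases hσ : σ ∈ R
    swap
    · have hno : ∀ τ, τ ++ σ ∉ R := fun τ h => hσ (hs.suffix h (List.suffix_append _ _))
      refine ⟨fun _ => 0, ?_, ?_⟩
      · rintro x _ _ ⟨τ, b, hb, rfl⟩
        exact absurd hb.1 (hno τ)
      · rintro x ⟨τ₀, h, _⟩
        exact absurd h (hno τ₀)
    have ih2 : ∀ n, ∃ e : List ℕ × List ℕ → X, n :: σ ∈ R →
        Lower e (BI (FT R T (n :: σ))) (BA (FT R T (n :: σ))) 1 ∧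
        Upper e (V2 R T (n :: σ)) (BA (FT R T (n :: σ))) K := by
      intro n
      by_cases hn : n :: σ ∈ R
      · obtain ⟨e, he⟩ := ih (n :: σ) ⟨hn, n, rfl⟩
        exact ⟨e, fun _ => he⟩
      · exact ⟨fun _ => 0, fun h => absurd h hn⟩
    choose E hE using ih2
    obtain ⟨e₀, he₀l, he₀u⟩ := hT σ.length
    -- the combined system
    let F := FT R T σ
    have hFnil : F [] = T σ.length := by
      ext l; simp [F, FT, hσ]
    let e : List ℕ → List ℕ → X := fun τ s =>
      if τ = [] then e₀ s else E (τ.getLastD 0) (τ.dropLast, s)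
    have heapp : ∀ τ n s, e (τ ++ [n]) s = E n (τ, s) := by
      intro τ n s
      simp [e, List.getLastD_eq_getLast?]
    have henil : e [] = e₀ := by
      funext s; simp [e]
    have hmem : ∀ τ n, (∃ l, l ∈ F (τ ++ [n])) → n :: σ ∈ R ∧ τ ++ n :: σ ∈ R := by
      rintro τ n ⟨l, hl, _⟩
      have : τ ++ n :: σ ∈ R := by simpa using hl
      exact ⟨hs.suffix this (List.suffix_append _ _), this⟩
    have hl : ∀ τ, Lower (e τ) (TI (F τ)) (TA (F τ)) 1 := by
      intro τ
      rcases List.eq_nil_or_concat' τ with rfl | ⟨τ', n, rfl⟩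
      · rw [hFnil, henil]; exact he₀l
      · rintro x hx _ ⟨b, hb, rfl⟩
        rw [spt_iff] at hx
        obtain ⟨hn, hn2⟩ := hmem τ' n ⟨b, hb⟩
        have h1 := (hE n hn).1.transfer (fun s => (τ', s)) (x := x) (S := br b) (S' := blk τ' b) (by
          intro i hi
          have := hx i hi
          simp only [F, FT_app] at this
          exact this) ⟨τ', b, by rw [← FT_app]; exact hb, rfl⟩ (by
          intro i _
          simp [br, blk])
        have h2 : e (τ' ++ [n]) = E n ∘ (fun s => (τ', s)) := by
          funext s; exact heapp τ' n s
        rw [h2]; exact h1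
    have hu : ∀ τ, ∃ C, Upper (e τ) (spt (TI (F τ))) (TA (F τ)) C := by
      intro τ
      refine ⟨K, ?_⟩
      rcases List.eq_nil_or_concat' τ with rfl | ⟨τ', n, rfl⟩
      · rw [hFnil, henil]; exact he₀u
      · intro x hx B hB hxB
        rw [forall_TA] at hxB
        by_cases hx0 : x = 0
        · subst hx0; simp; positivity
        obtain ⟨j, hj, _⟩ := exists_max x hx0
        obtain ⟨hn, hn2⟩ := hmem τ' n ⟨j, (hx j hj).1⟩
        have h2 : e (τ' ++ [n]) = E n ∘ (fun s => (τ', s)) := by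
          funext s; exact heapp τ' n s
        rw [h2]
        apply (hE n hn).2.transfer _ _ hB
        · rintro _ ⟨τ'', b, hb, rfl⟩
          by_cases hτ : τ'' = τ'
          · subst hτ
            refine ⟨br b, hxB b (by simp only [F]; rw [FT_app]; exact hb), ?_⟩
            intro i _
            simp [br, blk]
          · refine ⟨∅, by rw [ind_eq_zero (by simp)]; simpa using hB, ?_⟩
            intro i _
            simp [blk, Ne.symm hτ]
        · refine ⟨τ', hn2, mapDomain_spt (J := TI (F (τ' ++ [n]))) ?_ hx⟩
          intro s hs
          simp only [F, FT_app] at hs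
          exact ⟨hs, List.suffix_rfl⟩
    have hFSC : ∀ τ, SC (F τ) := fun τ a l h => ⟨h.1, hSC _ a l h.2⟩
    have hFUC : ∀ τ, UC (F τ) := fun τ l l' h h' => ⟨h.1, hUC _ l l' h.2 h'⟩
    obtain ⟨ρ, hρ, hinj, hlow⟩ := prune F hFSC hFUC
      (fun τ => (hWF (τ.length + σ.length)).mono (fun l h => h.2)) e hl hu
    have hρTI : ∀ τ s, s ∈ TI (F τ) → ρ τ s ∈ TI (F τ) := by
      intro τ s hs
      refine ⟨(hρ τ).mem (hFUC τ) hs.1, ?_⟩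
      intro h
      have := (hρ τ).length s
      rw [h] at this
      exact hs.2 (List.length_eq_zero_iff.1 (by simpa using this.symm))
    refine reset_sys hK hK1 (fun p : List ℕ × List ℕ => e p.1 (ρ p.1 p.2)) _ _ _ 4 (2 * K)
      (by norm_num) (V2_sub R T σ) hlow ?_
    rintro x ⟨τ₀, hτ₀, hx⟩ B hB hxB
    have hxB' : ∀ τ b, b ∈ F τ → |ind (blk τ b) x| ≤ B := fun τ b h => hxB _ ⟨τ, b, h, rfl⟩
    have hxx := Finsupp.filter_add_filter_not x (fun p : List ℕ × List ℕ => p.1 = [])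
    rw [← hxx, map_add]
    refine (norm_add_le _ _).trans ?_
    have hp1 : ‖LC (fun p : List ℕ × List ℕ => e p.1 (ρ p.1 p.2)) (x.filter (fun p => p.1 = []))‖
        ≤ K * B := by
      rw [LC_congr (e' := e₀ ∘ (fun p : List ℕ × List ℕ => ρ [] p.2))]
      swap
      · intro p hp
        have hp1 : p.1 = [] := by
          by_contra h; exact hp (Finsupp.filter_apply_neg (fun p : List ℕ × List ℕ => p.1 = []) _ h)
        simp only [hp1, henil, Function.comp]
      apply he₀u.transfer _ _ hB
      · rintro _ ⟨b, hb, rfl⟩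
        obtain ⟨b', hb', h⟩ := rho_max (hρ []) (hFSC []) (hinj [])
          ((hFSC []).suffix (hFnil ▸ hb) List.nil_suffix) b
        refine ⟨blk [] b', ?_, ?_⟩
        · rw [ind_filter]
          rw [ind_congr (B := blk [] b')]
          · exact hxB' [] b' hb'
          intro p _
          simp only [blk, Set.mem_inter_iff, Set.mem_ofPred_eq]
          tauto
        · intro p hp
          have hp1 : p.1 = [] := by
            by_contra h; exact hp (Finsupp.filter_apply_neg (fun p : List ℕ × List ℕ => p.1 = []) _ h)
          rw [Finsupp.filter_apply_pos (fun p : List ℕ × List ℕ => p.1 = []) _ hp1] at hp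
          have hp2 := (hx p hp).1.1
          rw [hp1] at hp2
          simp only [blk, br, Set.mem_ofPred_eq, hp1, true_and]
          exact (h _ hp2).symm
      · refine mapDomain_spt (J := BI F ∩ {p | p.1 = []}) ?_ ?_
        · rintro p ⟨hp, hp1⟩
          have hp : p.2 ∈ TI (F p.1) := hp
          have hp1 : p.1 = [] := hp1
          rw [hp1] at hp
          rw [← hFnil]
          exact hρTI _ _ hp
        · intro p hp
          have hp1 : p.1 = [] := by
            by_contra h; exact hp (Finsupp.filter_apply_neg (fun p : List ℕ × List ℕ => p.1 = []) _ h)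
          rw [Finsupp.filter_apply_pos (fun p : List ℕ × List ℕ => p.1 = []) _ hp1] at hp
          exact ⟨(hx p hp).1, hp1⟩
    have hp2 : ‖LC (fun p : List ℕ × List ℕ => e p.1 (ρ p.1 p.2)) (x.filter (fun p => ¬ p.1 = []))‖
        ≤ K * B := by
      have hsup : ∀ p, (x.filter (fun p => ¬ p.1 = [])) p ≠ 0 → p.1 ≠ [] ∧ x p ≠ 0 := by
        intro p hp
        have hp1 : p.1 ≠ [] := by
          intro h
          exact hp (Finsupp.filter_apply_neg (fun p : List ℕ × List ℕ => ¬ p.1 = []) _ (by simpa using h))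
        rw [Finsupp.filter_apply_pos (fun p : List ℕ × List ℕ => ¬ p.1 = []) _ hp1] at hp
        exact ⟨hp1, hp⟩
      rcases List.eq_nil_or_concat' τ₀ with rfl | ⟨τ', n, rfl⟩
      · have : x.filter (fun p => ¬ p.1 = []) = 0 := by
          ext p
          by_contra h
          obtain ⟨h1, h2⟩ := hsup p h
          exact h1 (List.suffix_nil.1 (hx p h2).2)
        rw [this]; simp; positivity
      · have hn2 : τ' ++ n :: σ ∈ R := by simpa using hτ₀
        have hn : n :: σ ∈ R := hs.suffix hn2 (List.suffix_append _ _)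
        have hsup2 : ∀ p, (x.filter (fun p => ¬ p.1 = [])) p ≠ 0 →
            ∃ τ, p.1 = τ ++ [n] ∧ τ <:+ τ' ∧ p.2 ∈ TI (F (τ ++ [n])) := by
          intro p hp
          obtain ⟨h1, h2⟩ := hsup p hp
          obtain ⟨h3, h4⟩ := hx p h2
          have h3 : p.2 ∈ TI (F p.1) := h3
          have h4 : p.1 <:+ τ' ++ [n] := h4
          rcases List.eq_nil_or_concat' p.1 with h5 | ⟨τ, m, h5⟩
          · exact absurd h5 h1
          · rw [h5] at h4 h3
            obtain ⟨q, hq⟩ := h4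
            rw [← List.append_assoc] at hq
            obtain ⟨h6, h7⟩ := List.append_inj' hq rfl
            simp only [List.cons.injEq, and_true] at h7
            subst h7
            exact ⟨τ, h5, ⟨q, h6⟩, h3⟩
        rw [LC_congr (e' := E n ∘ (fun p : List ℕ × List ℕ => (p.1.dropLast, ρ p.1 p.2)))]
        swap
        · intro p hp
          obtain ⟨τ, h1, -, -⟩ := hsup2 p hp
          simp only [Function.comp]
          rw [h1, heapp]
          simp
        apply (hE n hn).2.transfer _ _ hB
        · rintro _ ⟨τ, b, hb, rfl⟩
          rw [← FT_app] at hb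
          have hb : b ∈ F (τ ++ [n]) := hb
          obtain ⟨b', hb', h⟩ := rho_max (hρ (τ ++ [n])) (hFSC _) (hinj _)
            ((hFSC _).suffix hb List.nil_suffix) b
          refine ⟨blk (τ ++ [n]) b', ?_, ?_⟩
          · rw [ind_filter]
            rw [ind_congr (B := blk (τ ++ [n]) b')]
            · exact hxB' _ b' hb'
            intro p _
            simp only [blk, Set.mem_inter_iff, Set.mem_ofPred_eq]
            constructor
            · exact fun h => h.1
            · intro h
              refine ⟨h, ?_⟩
              rw [h.1]; simp
          · intro p hp
            obtain ⟨τ₁, h1, -, h3⟩ := hsup2 p hp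
            simp only [blk, Set.mem_ofPred_eq, h1, List.dropLast_concat, List.append_cancel_right_eq]
            constructor
            · rintro ⟨rfl, h5⟩
              exact ⟨rfl, (h _ h3.1).2 h5⟩
            · rintro ⟨rfl, h5⟩
              exact ⟨rfl, (h _ h3.1).1 h5⟩
        · refine ⟨τ', hn2, mapDomain_spt
            (J := {p : List ℕ × List ℕ | ∃ τ, p.1 = τ ++ [n] ∧ τ <:+ τ' ∧ p.2 ∈ TI (F (τ ++ [n]))}) ?_ hsup2⟩
          rintro p ⟨τ, h1, h2, h3⟩
          have h4 := hρTI _ _ h3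
          refine ⟨?_, ?_⟩
          · simp only [BI, Set.mem_ofPred_eq, h1, List.dropLast_concat]
            rw [← FT_app]; exact h4
          · simp only [Set.mem_ofPred_eq, h1, List.dropLast_concat]
            exact h2
    linarith

end ElC


namespace ElC

open Filter Topology

theorem BA_coord {θ : Type*} (F : θ → Set (List ℕ)) (hSC : ∀ i, SC (F i)) (x : θ × List ℕ →₀ ℝ)
    (hx : x ∈ spt (BI F)) (B : ℝ) (hB : 0 ≤ B) (h : ∀ S ∈ BA F, |ind S x| ≤ B) (p : θ × List ℕ) :
    |x p| ≤ 2 * B := by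
  by_cases hp : x p = 0
  · rw [hp]; simp; exact hB
  obtain ⟨h1, h2⟩ := hx p hp
  obtain ⟨i, s⟩ := p
  simp only at h1 h2
  cases s with
  | nil => exact absurd rfl h2
  | cons a s =>
    have h3 := h _ ⟨i, _, h1, rfl⟩
    have h4 := h _ ⟨i, _, hSC i _ _ h1, rfl⟩
    rw [ind_blk_cons] at h3
    have := abs_sub (x (i, a :: s) + ind (blk i s) x) (ind (blk i s) x)
    rw [add_sub_cancel_right] at this
    linarith

theorem lemma2 {X : Type} [NormedAddCommGroup X]
    [NormedSpace ℝ X] [CompleteSpace X] [TopologicalSpace.SeparableSpace X]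
    {K : ℝ} (hK : IsKElastic X K) (hK1 : 0 ≤ K)
    (T : ℕ → Set (List ℕ)) (hSC : ∀ i, SC (T i)) (hUC : ∀ i, UC (T i)) (hWF : ∀ i, WF (T i))
    (hT : ∀ i, PT X K (T i)) :
    ∃ e : ℕ × List ℕ → X, Lower e (BI T) (BA T) 2 ∧ Upper e (spt (BI T)) (BA T) (K + 1) := by
  apply closing _ _ _ hK1
  · exact fun x hx B hB h i => BA_coord T hSC x hx B hB h i
  · intro R hs hw
    obtain ⟨e, hl, hu⟩ := claim2 hK hK1 T hSC hUC hWF hT R hs hw []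
    refine ⟨fun r => match (Encodable.decode r.length : Option (ℕ × List ℕ)) with
      | none => 0
      | some p => e (suf p.1 r, p.2), fun r hr => ?_⟩
    have hle : ∀ p : ℕ × List ℕ, p.1 ≤ Encodable.encode p := by
      intro p
      rw [show p = (p.1, p.2) from rfl, Encodable.encode_prod_val]
      exact Nat.left_le_pair _ _
    have hfun : ∀ p : ℕ × List ℕ, Encodable.encode p < r.length + 1 →
        (match (Encodable.decode (suf (Encodable.encode p) r).length : Option (ℕ × List ℕ)) with
          | none => 0
          | some q => e (suf q.1 (suf (Encodable.encode p) r), q.2)) =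
        (e ∘ (fun p : ℕ × List ℕ => (suf p.1 r, p.2))) p := by
      intro p hp
      rw [length_suf, min_eq_left (by omega), Encodable.encodek]
      simp only [Function.comp]
      rw [suf_suf (hle p)]
    have hlen : ∀ p : ℕ × List ℕ, Encodable.encode p < r.length + 1 → (suf p.1 r).length = p.1 := by
      intro p hp
      have := hle p
      rw [length_suf, min_eq_left (by omega)]
    have hmaps : ∀ p : ℕ × List ℕ, p ∈ BI T ∩ {i | Encodable.encode i < r.length + 1} →
        (suf p.1 r, p.2) ∈ BI (FT R T []) ∩ {p | p.1 <:+ r} := by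
      rintro p ⟨hp1, hp2⟩
      refine ⟨⟨⟨?_, ?_⟩, hp1.2⟩, suf_suffix _ _⟩
      · rw [List.append_nil]; exact hs.suffix hr (suf_suffix _ _)
      · simp only [hlen p hp2]
        exact hp1.1
    constructor
    · rintro x hx _ ⟨i, b, hb, rfl⟩
      rw [spt_iff] at hx
      rw [LC_congr (fun p hp => hfun p (hx p hp).2)]
      by_cases hi : i ≤ r.length
      · refine hl.transfer (S' := blk (suf i r) b) _ (fun p hp => (hmaps p (hx p hp)).1)
          ⟨suf i r, b, ⟨?_, ?_⟩, rfl⟩ ?_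
        · rw [List.append_nil]; exact hs.suffix hr (suf_suffix _ _)
        · rw [length_suf, min_eq_left hi]; exact hb
        · intro p hp
          have h2 := hlen p (hx p hp).2
          simp only [blk, Set.mem_ofPred_eq]
          refine and_congr_left fun _ => ⟨fun h => by rw [h], fun h => ?_⟩
          rw [← h2, h, length_suf, min_eq_left hi]
      · rw [ind_eq_zero]
        · simp
        · rintro p hp ⟨h, _⟩
          have h1 := hle p
          have h2 : Encodable.encode p < r.length + 1 := (hx p hp).2
          omega
    · intro x hx B hB hxB
      rw [LC_congr (fun p hp => hfun p (hx p hp).2)]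
      apply hu.transfer _ _ hB
      · rintro _ ⟨τ, b, ⟨hb1, hb2⟩, rfl⟩
        by_cases hτ : τ <:+ r
        · refine ⟨blk τ.length b, hxB _ ⟨_, b, hb2, rfl⟩, ?_⟩
          intro p hp
          have h2 := hlen p (hx p hp).2
          simp only [blk, Set.mem_ofPred_eq]
          refine and_congr_left fun _ => ⟨fun h => by rw [h]; exact suf_eq hτ, fun h => ?_⟩
          rw [← h2, h]
        · refine ⟨∅, by rw [ind_eq_zero (by simp)]; simpa using hB, ?_⟩
          intro p _
          simp only [Set.mem_empty_iff_false, false_iff]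
          rintro ⟨h, _⟩
          exact hτ (h ▸ suf_suffix _ _)
      · refine ⟨r, by simpa using hr, mapDomain_spt
          (J := BI T ∩ {i | Encodable.encode i < r.length + 1}) hmaps hx⟩

end ElC


namespace ElC

open Filter Topology

theorem ind_union {ι : Type*} {A B C : Set ι} {x : ι →₀ ℝ}
    (h : ∀ i, x i ≠ 0 → (i ∈ C ↔ i ∈ A ∨ i ∈ B)) (h' : ∀ i, x i ≠ 0 → ¬ (i ∈ A ∧ i ∈ B)) :
    ind C x = ind A x + ind B x := by
  classical
  unfold ind
  simp only [Finsupp.linearCombination_apply, Finsupp.sum, ← Finset.sum_add_distrib, ← smul_add]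
  apply Finset.sum_congr rfl
  intro j hj
  rw [Finsupp.mem_support_iff] at hj
  congr 1
  have h1 := h j hj
  have h2 := h' j hj
  simp only [Set.indicator_apply, h1]
  by_cases h3 : j ∈ A <;> by_cases h4 : j ∈ B <;> simp_all

theorem PT_of {X : Type} [NormedAddCommGroup X]
    [NormedSpace ℝ X] [CompleteSpace X] {K : ℝ} (hK : IsKElastic X K) (hK1 : 0 ≤ K)
    {T : Set (List ℕ)} (e : List ℕ → X) (M C : ℝ) (hM : 0 ≤ M) (hl : Lower e (TI T) (TA T) M)
    (hu : Upper e (spt (TI T)) (TA T) C) : PT X K T :=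
  reset_sys hK hK1 e _ _ _ M C hM subset_rfl hl hu

theorem PT_empty {X : Type} [NormedAddCommGroup X]
    [NormedSpace ℝ X] {K : ℝ} (hK1 : 0 ≤ K)
    {T : Set (List ℕ)} (h : ∀ l, l ∉ T) : PT X K T := by
  refine ⟨fun _ => 0, ?_, ?_⟩
  · rintro x _ _ ⟨b, hb, rfl⟩
    exact absurd hb (h b)
  · intro x hx B hB _
    have : x = 0 := by
      ext p
      by_contra hp
      exact h p (hx p hp).1
    rw [this]; simp; positivity

def B0 : Set (List ℕ) := {l | l.length ≤ 1}

theorem B0_SC : SC B0 := by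
  intro a l h
  simp only [B0, Set.mem_ofPred_eq, List.length_cons] at h ⊢
  omega

theorem B0_UC : UC B0 := by
  intro l l' h h'
  simp only [B0, Set.mem_ofPred_eq] at h ⊢
  rw [← h'.length_eq]; exact h

theorem B0_WF : WF B0 := by
  apply wf_of_no_chain
  intro f hf
  have h1 := chain_length (fun n => (hf n).2) 2
  have h2 : (f 2).length ≤ 1 := (hf 1).1
  omega

theorem br_single {n : ℕ} {s : List ℕ} (hs : s ≠ []) : s <:+ [n] ↔ s = [n] := by
  rw [List.suffix_cons_iff, List.suffix_nil]
  simp [hs]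

theorem PT_B0 {X : Type} [NormedAddCommGroup X]
    [NormedSpace ℝ X] [CompleteSpace X] [TopologicalSpace.SeparableSpace X]
    {K : ℝ} (hK : IsKElastic X K) (hK1 : 0 ≤ K) (hX : ¬ FiniteDimensional ℝ X) : PT X K B0 := by
  obtain ⟨v, hl, hu⟩ := lemma1 hK hK1 hX
  have hB : ∀ s ∈ TI B0, s = [s.headD 0] := by
    rintro s ⟨h1, h2⟩
    simp only [B0, Set.mem_ofPred_eq] at h1
    match s, h2, h1 with
    | [a], _, _ => rfl
  refine PT_of hK hK1 (v ∘ fun s => s.headD 0) 2 (K + 1) (by norm_num) ?_ ?_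
  · rintro x hx _ ⟨b, hb, rfl⟩
    rw [spt_iff] at hx
    by_cases hb0 : b = []
    · subst hb0
      rw [ind_eq_zero]
      · simp
      · intro s hs h
        exact (hx s hs).2 (List.suffix_nil.1 h)
    · have hb1 := hB b ⟨hb, hb0⟩
      refine hl.transfer (S' := {b.headD 0}) _ (fun _ _ => Set.mem_univ _) ⟨_, rfl⟩ ?_
      intro s hs
      have h1 := hB s (hx s hs)
      have h2 := (hx s hs).2
      simp only [br, Set.mem_ofPred_eq, Set.mem_singleton_iff]
      constructor
      · intro h
        rw [hb1, br_single h2] at h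
        rw [h]; rfl
      · intro h
        rw [h1, hb1, h]
  · intro x hx B hB' hxB
    rw [forall_TA] at hxB
    refine hu.transfer _ (fun _ _ => Set.mem_univ _) hB' ?_
    rintro _ ⟨n, rfl⟩
    refine ⟨br [n], hxB _ (by simp [B0]), ?_⟩
    intro s hs
    have h1 := hB s (hx s hs)
    have h2 := (hx s hs).2
    simp only [br, Set.mem_ofPred_eq, Set.mem_singleton_iff, br_single h2]
    constructor
    · intro h; rw [h]; rfl
    · intro h; rw [h1, h]

theorem lemma3 {X : Type} [NormedAddCommGroup X]
    [NormedSpace ℝ X] [CompleteSpace X] [TopologicalSpace.SeparableSpace X]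
    {K : ℝ} (hK : IsKElastic X K) (hK1 : 0 ≤ K) (hX : ¬ FiniteDimensional ℝ X)
    (T : Set (List ℕ)) (hSC : SC T) (hUC : UC T) (hWF : WF T) : PT X K T := by
  suffices h : ∀ t, PT X K {l | l ++ t ∈ T} by
    have := h []
    simpa using this
  intro t
  induction t using hWF.induction with
  | _ t ih =>
    have hne : ∀ t, t ∉ T → ∀ l, l ∉ {l | l ++ t ∈ T} := fun t ht l hl =>
      ht (hSC.suffix hl (List.suffix_append _ _))
    by_cases ht : t ∈ T
    swap
    · exact PT_empty hK1 (hne t ht)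
    let Tn : ℕ → Set (List ℕ) := fun n => {l | l ++ n :: t ∈ T}
    let F : ℕ → Set (List ℕ) := fun i => match i with
      | 0 => B0
      | n + 1 => Tn n
    have hTn : ∀ n, SC (Tn n) ∧ UC (Tn n) ∧ WF (Tn n) ∧ PT X K (Tn n) := by
      intro n
      refine ⟨fun a l h => hSC _ _ h, fun l l' h h' => hUC _ _ h (List.rel_append h' (List.forall₂_refl _)), ?_, ?_⟩
      · apply wf_of_no_chain
        intro f hf
        apply hWF.no_chain (fun k => f k ++ n :: t)
        intro k
        refine ⟨(hf k).1, ?_⟩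
        obtain ⟨a, ha⟩ := (hf k).2
        exact ⟨a, by simp [ha]⟩
      · by_cases hn : n :: t ∈ T
        · exact ih _ ⟨hn, n, rfl⟩
        · exact PT_empty hK1 (hne _ hn)
    obtain ⟨E, hl, hu⟩ := lemma2 hK hK1 F
      (fun i => by cases i; exacts [B0_SC, (hTn _).1])
      (fun i => by cases i; exacts [B0_UC, (hTn _).2.1])
      (fun i => by cases i; exacts [B0_WF, (hTn _).2.2.1])
      (fun i => by cases i; exacts [PT_B0 hK hK1 hX, (hTn _).2.2.2])
    -- description of `kap` preimages
    have hk0 : ∀ s n, s ≠ [] → (s ∈ br [n] ↔ kap s ∈ blk 0 [n]) := by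
      intro s n hs
      rcases cons_cases s hs with ⟨m, rfl⟩ | ⟨a, r, m, rfl⟩
      · rw [kap_one]; simp [br, blk]
      · rw [kap_app]; simp [br, blk, br_single]
    have hk0' : ∀ s, s ≠ [] → kap s ∉ blk 0 [] := by
      intro s hs
      rcases cons_cases s hs with ⟨m, rfl⟩ | ⟨a, r, m, rfl⟩
      · rw [kap_one]; simp [blk]
      · rw [kap_app]; simp [blk]
    have hk1 : ∀ s n r, s ≠ [] → (s ∈ br (r ++ [n]) ↔ s ∈ br [n] ∨ s ∈ kap ⁻¹' (blk (n+1) r)) := by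
      intro s n r hs
      rcases cons_cases s hs with ⟨m, rfl⟩ | ⟨a, q, m, rfl⟩
      · simp only [Set.mem_preimage]
        rw [kap_one]
        simp only [br, blk, Set.mem_ofPred_eq, br_single hs]
        constructor
        · rintro ⟨q, hq⟩
          left
          exact (List.append_inj' hq rfl).2
        · rintro (h | h)
          · rw [h]; exact List.suffix_append _ _
          · omega
      · simp only [Set.mem_preimage]
        rw [kap_app]
        simp only [br, blk, Set.mem_ofPred_eq, br_single hs]
        constructor
        · rintro ⟨l, hq⟩
          right
          rw [← List.cons_append, ← List.append_assoc] at hq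
          obtain ⟨h1, h2⟩ := List.append_inj' hq rfl
          simp only [List.cons.injEq, and_true] at h2
          exact ⟨by rw [h2], ⟨l, h1⟩⟩
        · rintro (h | ⟨h1, l, h2⟩)
          · simp at h
          · refine ⟨l, ?_⟩
            rw [← List.cons_append, ← List.append_assoc, h2]
            rw [show m = n by omega]
    have hdisj : ∀ s n r, s ≠ [] → ¬ (s ∈ br [n] ∧ s ∈ kap ⁻¹' (blk (n+1) r)) := by
      rintro s n r hs ⟨h1, h2⟩
      rw [hk0 s n hs] at h1
      have := h1.1
      have := h2.1
      omega
    have hmaps : ∀ s ∈ TI {l | l ++ t ∈ T}, kap s ∈ BI F := by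
      rintro s ⟨h1, h2⟩
      rcases cons_cases s h2 with ⟨m, rfl⟩ | ⟨a, r, m, rfl⟩
      · rw [kap_one]; exact ⟨by simp [F, B0], by simp⟩
      · rw [kap_app]; exact ⟨by simpa [F, Tn] using h1, by simp⟩
    refine PT_of hK hK1 (E ∘ kap) 4 (2 * (K + 1)) (by norm_num) ?_ ?_
    · rintro x hx _ ⟨b, hb, rfl⟩
      rw [spt_iff] at hx
      rcases List.eq_nil_or_concat' b with rfl | ⟨r, n, rfl⟩
      · rw [ind_eq_zero]
        · simp
        · intro s hs h
          exact (hx s hs).2 (List.suffix_nil.1 h)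
      · rw [ind_union (fun s hs => hk1 s n r (hx s hs).2) (fun s hs => hdisj s n r (hx s hs).2)]
        have h1 := hl.transfer kap (x := x) (S := br [n]) (S' := blk 0 [n])
          (fun s hs => hmaps s (hx s hs)) ⟨0, [n], by simp [F, B0], rfl⟩
          (fun s hs => hk0 s n (hx s hs).2)
        have h2 := hl.transfer kap (x := x) (S := kap ⁻¹' (blk (n+1) r)) (S' := blk (n+1) r)
          (fun s hs => hmaps s (hx s hs)) ⟨n+1, r, by simpa [F, Tn] using hb, rfl⟩
          (fun s hs => Iff.rfl)
        refine (abs_add_le _ _).trans ?_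
        linarith
    · intro x hx B hB hxB
      rw [forall_TA] at hxB
      have hx1 : ∀ n, |ind (br [n]) x| ≤ B := by
        intro n
        by_cases hn : [n] ++ t ∈ T
        · exact hxB _ hn
        · rw [ind_eq_zero]
          · simpa using hB
          · intro s hs h
            rw [br, Set.mem_ofPred_eq, br_single (hx s hs).2] at h
            exact hn (h ▸ (hx s hs).1)
      have hx2 : ‖LC (E ∘ kap) x‖ ≤ (K + 1) * (2 * B) := by
        apply hu.transfer _ _ (by positivity)
        · rintro _ ⟨i, b, hb, rfl⟩
          cases i with
          | zero =>
            by_cases hb0 : b = []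
            · subst hb0
              refine ⟨∅, by rw [ind_eq_zero (by simp)]; simpa using hB, ?_⟩
              intro s hs
              have := hk0' s (hx s hs).2
              simp [this]
            · obtain ⟨n, rfl⟩ : ∃ n, b = [n] := by
                have hb : b.length ≤ 1 := hb
                match b, hb0, hb with
                | [a], _, _ => exact ⟨a, rfl⟩
              exact ⟨br [n], (hx1 n).trans (by linarith), fun s hs => hk0 s n (hx s hs).2⟩
          | succ n =>
            refine ⟨kap ⁻¹' (blk (n+1) b), ?_, fun s hs => Iff.rfl⟩
            have h1 := ind_union (fun s hs => hk1 s n b (hx s hs).2)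
              (fun s hs => hdisj s n b (hx s hs).2)
            have h2 := hx1 n
            have h3 := hxB (b ++ [n]) (by simpa [F, Tn] using hb)
            have h4 := abs_sub (ind (br (b ++ [n])) x) (ind (br [n]) x)
            rw [h1, add_sub_cancel_left, ← h1] at h4
            linarith
        · exact mapDomain_spt hmaps hx
      linarith

end ElC


namespace ElC

open Filter Topology

/-! ### The full tree -/

def FA : Set (Set (List ℕ)) := {S | ∃ b, S = br b}

def trL (r : List ℕ) : List ℕ → List (List ℕ)
  | [] => [suf (Encodable.encode ([] : List ℕ)) r]
  | a :: l => suf (Encodable.encode (a :: l)) r :: trL r l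

def tr (r l : List ℕ) : List ℕ := (trL r l).map Encodable.encode

theorem tr_nil (r : List ℕ) : tr r [] = [Encodable.encode (suf (Encodable.encode ([] : List ℕ)) r)] := rfl

theorem tr_cons (r l : List ℕ) (a : ℕ) :
    tr r (a :: l) = Encodable.encode (suf (Encodable.encode (a :: l)) r) :: tr r l := rfl

theorem trL_length (r l : List ℕ) : (trL r l).length = l.length + 1 := by
  induction l with
  | nil => rfl
  | cons a l ih => simp [trL, ih]

theorem tr_length (r l : List ℕ) : (tr r l).length = l.length + 1 := by
  rw [tr, List.length_map, trL_length]

theorem trL_suf {r l : List ℕ} {k : ℕ} (h : Encodable.encode l ≤ k) : trL (suf k r) l = trL r l := by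
  induction l with
  | nil => simp only [trL]; rw [suf_suf h]
  | cons a l ih =>
    simp only [trL]
    rw [suf_suf h, ih ((encode_tail a l).le.trans h)]

theorem trL_mem {r l : List ℕ} {q : List ℕ} (hq : q ∈ trL r l) :
    ∃ k ≤ Encodable.encode l, q = suf k r := by
  induction l with
  | nil =>
    simp only [trL, List.mem_singleton] at hq
    exact ⟨_, le_rfl, hq⟩
  | cons a l ih =>
    simp only [trL, List.mem_cons] at hq
    rcases hq with h | h
    · exact ⟨_, le_rfl, h⟩
    · obtain ⟨k, hk, h⟩ := ih h
      exact ⟨k, hk.trans (encode_tail a l).le, h⟩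

theorem trL_pairwise {r l : List ℕ} (hl : Encodable.encode l ≤ r.length) :
    (trL r l).Pairwise (fun q q' => q' <:+ q ∧ q' ≠ q) := by
  induction l with
  | nil => simp [trL]
  | cons a l ih =>
    simp only [trL, List.pairwise_cons]
    refine ⟨?_, ih ((encode_tail a l).le.trans hl)⟩
    intro q hq
    obtain ⟨k, hk, rfl⟩ := trL_mem hq
    have h1 := encode_tail a l
    constructor
    · rw [← suf_suf (show k ≤ Encodable.encode (a :: l) by omega)]
      exact suf_suffix _ _
    · intro h
      have := congrArg List.length h
      rw [length_suf, length_suf] at this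
      omega

theorem tr_suffix {r l l' : List ℕ} (h : l <:+ l') : tr r l <:+ tr r l' := by
  obtain ⟨q, rfl⟩ := h
  induction q with
  | nil => exact List.suffix_rfl
  | cons a q ih =>
    rw [List.cons_append, tr_cons]
    exact ih.trans (List.suffix_cons _ _)

theorem tr_inj {r l l' : List ℕ} (hl : Encodable.encode l ≤ r.length)
    (hl' : Encodable.encode l' ≤ r.length) (h : tr r l = tr r l') : l = l' := by
  have hh : ∀ m, (tr r m).head? = some (Encodable.encode (suf (Encodable.encode m) r)) := by
    intro m
    cases m <;> rfl
  have h1 := hh l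
  rw [h, hh l'] at h1
  simp only [Option.some.injEq] at h1
  have h2 := congrArg List.length (Encodable.encode_injective h1)
  rw [length_suf, length_suf, min_eq_left hl, min_eq_left hl'] at h2
  exact Encodable.encode_injective h2.symm

theorem encode_suffix {l l' : List ℕ} (h : l <:+ l') : Encodable.encode l ≤ Encodable.encode l' := by
  obtain ⟨q, rfl⟩ := h
  induction q with
  | nil => exact le_rfl
  | cons a q ih => exact ih.trans (encode_tail _ _).le

theorem tr_suffix_iff {r l l' : List ℕ} (hl : Encodable.encode l ≤ r.length)
    (hl' : Encodable.encode l' ≤ r.length) : tr r l <:+ tr r l' ↔ l <:+ l' := by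
  refine ⟨fun h => ?_, tr_suffix⟩
  have hlen := h.length_le
  rw [tr_length, tr_length] at hlen
  have h1 : tr r (suf l.length l') <:+ tr r l' := tr_suffix (suf_suffix _ _)
  have h2 : tr r l = tr r (suf l.length l') := by
    apply List.IsSuffix.eq_of_length
    · apply List.suffix_of_suffix_length_le h h1
      rw [tr_length, tr_length, length_suf]; omega
    · rw [tr_length, tr_length, length_suf]; omega
  rw [tr_inj hl ((encode_suffix (suf_suffix _ _)).trans hl') h2]
  exact suf_suffix _ _

theorem trunc (m : ℕ) (b : List ℕ) : ∃ b', b' <:+ b ∧ Encodable.encode b' ≤ m ∧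
    ∀ s : List ℕ, Encodable.encode s ≤ m → (s <:+ b ↔ s <:+ b') := by
  induction b with
  | nil => exact ⟨[], List.suffix_rfl, by simp, fun _ _ => Iff.rfl⟩
  | cons a b ih =>
    by_cases h : Encodable.encode (a :: b) ≤ m
    · exact ⟨_, List.suffix_rfl, h, fun _ _ => Iff.rfl⟩
    · obtain ⟨b', h1, h2, h3⟩ := ih
      refine ⟨b', h1.trans (List.suffix_cons _ _), h2, fun s hs => ?_⟩
      rw [← h3 s hs, List.suffix_cons_iff]
      constructor
      · rintro (rfl | h')
        · exact absurd hs h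
        · exact h'
      · exact Or.inr

theorem tr_max (r : List ℕ) (b : List ℕ) :
    (∀ s, Encodable.encode s ≤ r.length → ¬ tr r s <:+ b) ∨
    ∃ l, ∀ s, Encodable.encode s ≤ r.length → (s <:+ l ↔ tr r s <:+ b) := by
  induction b with
  | nil =>
    left
    intro s _ h
    have := h.length_le
    rw [tr_length] at this
    simp at this
  | cons a b ih =>
    by_cases hex : ∃ l, Encodable.encode l ≤ r.length ∧ tr r l = a :: b
    · obtain ⟨l, hl, hlb⟩ := hex
      right
      refine ⟨l, fun s hs => ?_⟩
      rw [← hlb, tr_suffix_iff hs hl]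
    · have hiff : ∀ s, Encodable.encode s ≤ r.length → (tr r s <:+ a :: b ↔ tr r s <:+ b) := by
        intro s hs
        rw [List.suffix_cons_iff]
        constructor
        · rintro (h | h)
          · exact absurd ⟨s, hs, h⟩ hex
          · exact h
        · exact Or.inr
      rcases ih with h | ⟨l, hl⟩
      · left; intro s hs; rw [hiff s hs]; exact h s hs
      · right; exact ⟨l, fun s hs => by rw [hiff s hs]; exact hl s hs⟩

/-- the tree of strictly increasing chains in `R` -/
def CT (R : Set (List ℕ)) : Set (List ℕ) :=
  {t | ∃ L : List (List ℕ), t = L.map Encodable.encode ∧ (∀ q ∈ L, q ∈ R) ∧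
    L.Pairwise (fun q q' => q' <:+ q ∧ q' ≠ q)}

theorem CT_SC (R : Set (List ℕ)) : SC (CT R) := by
  rintro a l ⟨L, h1, h2, h3⟩
  cases L with
  | nil => simp at h1
  | cons q L =>
    simp only [List.map_cons, List.cons.injEq] at h1
    exact ⟨L, h1.2, fun q hq => h2 q (List.mem_cons_of_mem _ hq), (List.pairwise_cons.1 h3).2⟩

theorem CT_WF {R : Set (List ℕ)} (hs : SC R) (hw : WF R) : WF (CT R) := by
  have hw2 : WellFounded (fun l' l : List ℕ => l' ∈ R ∧ l <:+ l' ∧ l ≠ l') := by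
    refine Subrelation.wf ?_ (WellFounded.transGen hw)
    rintro l' l ⟨h1, ⟨q, rfl⟩, h3⟩
    induction q with
    | nil => exact absurd rfl h3
    | cons a q ih =>
      by_cases hq : q = []
      · subst hq
        exact Relation.TransGen.single ⟨h1, a, rfl⟩
      · refine Relation.TransGen.head ⟨h1, a, rfl⟩ (ih (hs _ _ h1) ?_)
        intro h
        have := congrArg List.length h
        simp at this
        exact hq this
  apply wf_of_no_chain
  intro f hf
  rw [wellFounded_iff_isEmpty_descending_chain] at hw2
  let g : ℕ → List ℕ := fun n => (Encodable.decode ((f (n+1)).headD 0)).getD []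
  refine hw2.false ⟨g, fun n => ?_⟩
  obtain ⟨L, h1, h2, h3⟩ := (hf (n+1)).1
  obtain ⟨a, ha⟩ := (hf (n+1)).2
  obtain ⟨a', ha'⟩ := (hf n).2
  rw [ha, ha'] at h1
  match L, h1, h2, h3 with
  | q :: q' :: L', h1, h2, h3 =>
    simp only [List.map_cons, List.cons.injEq] at h1
    have e1 : g (n+1) = q := by
      simp only [g]
      rw [ha, List.headD_cons, h1.1, Encodable.encodek]; rfl
    have e2 : g n = q' := by
      simp only [g]
      rw [ha', List.headD_cons, h1.2.1, Encodable.encodek]; rfl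
    rw [e1, e2]
    have := (List.pairwise_cons.1 h3).1 q' (by simp)
    exact ⟨h2 q (by simp), this.1, this.2⟩

theorem lemma4 {X : Type} [NormedAddCommGroup X]
    [NormedSpace ℝ X] [CompleteSpace X] [TopologicalSpace.SeparableSpace X]
    {K : ℝ} (hK : IsKElastic X K) (hK1 : 0 ≤ K) (hX : ¬ FiniteDimensional ℝ X) :
    ∃ v : List ℕ → X, Lower v Set.univ FA 2 ∧ Upper v (spt Set.univ) FA (K + 1) := by
  apply closing _ _ _ hK1
  · intro x _ B hB h l
    cases l with
    | nil =>
      have h1 := h _ ⟨[], rfl⟩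
      rw [ind_congr (B := {[]}) (by intro i _; simp [br]), ind_singleton] at h1
      linarith
    | cons a s =>
      have h3 := h _ ⟨a :: s, rfl⟩
      have h4 := h _ ⟨s, rfl⟩
      rw [ind_br_cons] at h3
      have := abs_sub (x (a :: s) + ind (br s) x) (ind (br s) x)
      rw [add_sub_cancel_right] at this
      linarith
  · intro R hs hw
    have hUC := up_UC (CT R)
    obtain ⟨e, hl, hu⟩ := lemma3 hK hK1 hX (up (CT R)) (up_SC (CT_SC R)) hUC
      (up_WF (CT_SC R) (CT_WF hs hw))
    refine ⟨fun r => match (Encodable.decode r.length : Option (List ℕ)) with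
      | none => 0
      | some l => e (tr r l), fun r hr => ?_⟩
    have hfun : ∀ l : List ℕ, Encodable.encode l < r.length + 1 →
        (match (Encodable.decode (suf (Encodable.encode l) r).length : Option (List ℕ)) with
          | none => 0
          | some q => e (tr (suf (Encodable.encode l) r) q)) = (e ∘ tr r) l := by
      intro l hl
      rw [length_suf, min_eq_left (by omega), Encodable.encodek]
      simp only [Function.comp, tr]
      rw [trL_suf le_rfl]
    have hT : ∀ l : List ℕ, Encodable.encode l ≤ r.length → tr r l ∈ up (CT R) := by
      intro l hl
      apply subset_up
      refine ⟨trL r l, rfl, ?_, trL_pairwise hl⟩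
      intro q hq
      obtain ⟨k, _, rfl⟩ := trL_mem hq
      exact hs.suffix hr (suf_suffix _ _)
    have hTI : ∀ l ∈ Set.univ ∩ {l : List ℕ | Encodable.encode l < r.length + 1},
        tr r l ∈ TI (up (CT R)) := by
      rintro l ⟨-, hl⟩
      have hl : Encodable.encode l < r.length + 1 := hl
      refine ⟨hT l (by omega), ?_⟩
      intro h
      have := tr_length r l
      rw [h] at this
      simp at this
    constructor
    · rintro x hx _ ⟨b, rfl⟩
      rw [spt_iff] at hx
      rw [LC_congr (fun p hp => hfun p (hx p hp).2)]
      obtain ⟨b', -, h2, h3⟩ := trunc r.length b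
      refine hl.transfer (S' := br (tr r b')) _ (fun p hp => hTI p (hx p hp)) ⟨_, hT b' h2, rfl⟩ ?_
      intro s hs
      have h4 : Encodable.encode s < r.length + 1 := (hx s hs).2
      have h5 : Encodable.encode s ≤ r.length := by omega
      exact (h3 s h5).trans (tr_suffix_iff h5 h2).symm
    · intro x hx B hB hxB
      rw [LC_congr (fun p hp => hfun p (hx p hp).2)]
      apply hu.transfer _ (mapDomain_spt hTI hx) hB
      rintro _ ⟨b, hb, rfl⟩
      rcases tr_max r b with h | ⟨l, h⟩
      · refine ⟨∅, by rw [ind_eq_zero (by simp)]; simpa using hB, ?_⟩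
        intro s hs
        have h4 : Encodable.encode s < r.length + 1 := (hx s hs).2
        have := h s (by omega)
        simp [br, this]
      · refine ⟨br l, hxB _ ⟨l, rfl⟩, ?_⟩
        intro s hs
        have h4 : Encodable.encode s < r.length + 1 := (hx s hs).2
        exact h s (by omega)

end ElC


namespace ElC

open Filter Topology

/-! ### Embedding `C([0,1])` -/

def wt : List ℕ → ℕ
  | [] => 0
  | n :: q => wt q + n + 1

noncomputable def pp : List ℕ → ℝ
  | [] => 0
  | n :: q => pp q + (1/2 : ℝ) ^ (wt q + n + 1)

theorem pp_nonneg (q : List ℕ) : 0 ≤ pp q := by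
  induction q with
  | nil => simp [pp]
  | cons n q ih => simp only [pp]; positivity

theorem half_step (n : ℕ) (q : List ℕ) :
    2 * (1/2 : ℝ) ^ (wt (n :: q)) ≤ (1/2 : ℝ) ^ (wt q) := by
  have h : (1/2 : ℝ) ^ (wt q + n) ≤ (1/2 : ℝ) ^ (wt q) :=
    pow_le_pow_of_le_one (by norm_num) (by norm_num) (by omega)
  simp only [wt]
  rw [pow_succ]
  linarith

theorem pp_cons (n : ℕ) (q : List ℕ) : pp (n :: q) = pp q + (1/2 : ℝ) ^ (wt (n :: q)) := rfl

theorem pp_le (q : List ℕ) : pp q ≤ 1 - (1/2 : ℝ) ^ (wt q) := by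
  induction q with
  | nil => simp [pp, wt]
  | cons n q ih =>
    have := half_step n q
    rw [pp_cons]
    linarith

noncomputable def pI (q : List ℕ) : Set.Icc (0:ℝ) 1 :=
  ⟨pp q, pp_nonneg q, (pp_le q).trans (by have : (0:ℝ) ≤ (1/2 : ℝ) ^ (wt q) := by positivity
                                          linarith)⟩

theorem pI_greedy (W : ℕ) (y : ℝ) (h0 : 0 ≤ y) (h1 : y ≤ 1) :
    ∃ q, wt q ≤ W ∧ pp q ≤ y ∧ y ≤ pp q + (1/2 : ℝ) ^ W := by
  induction W with
  | zero => exact ⟨[], by simp [wt], by simpa [pp], by simpa [pp]⟩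
  | succ W ih =>
    obtain ⟨q, hq, h2, h3⟩ := ih
    by_cases h : y ≤ pp q + (1/2 : ℝ) ^ (W + 1)
    · exact ⟨q, by omega, h2, h⟩
    · have e : wt ((W - wt q) :: q) = W + 1 := by simp only [wt]; omega
      refine ⟨(W - wt q) :: q, e.le, ?_, ?_⟩
      · rw [pp_cons, e]; linarith
      · rw [pp_cons, e]
        have : (1/2 : ℝ) ^ (W + 1) = (1/2 : ℝ) ^ W / 2 := by rw [pow_succ]; ring
        linarith

theorem pI_dense : DenseRange pI := by
  intro z
  rw [Metric.mem_closure_range_iff]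
  intro ε hε
  obtain ⟨W, hW⟩ := exists_pow_lt_of_lt_one hε (by norm_num : (1/2 : ℝ) < 1)
  obtain ⟨q, -, h2, h3⟩ := pI_greedy W z.1 z.2.1 z.2.2
  refine ⟨q, ?_⟩
  rw [Subtype.dist_eq, Real.dist_eq]
  change |z.1 - pp q| < ε
  rw [abs_lt]
  constructor <;> linarith

theorem wt_finite (W : ℕ) : {q : List ℕ | wt q ≤ W}.Finite := by
  induction W with
  | zero =>
    refine (Set.finite_singleton ([] : List ℕ)).subset ?_
    intro q hq
    cases q with
    | nil => rfl
    | cons n q =>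
      have : wt (n :: q) ≤ 0 := hq
      simp only [wt] at this
      omega
  | succ W ih =>
    refine ((Set.finite_singleton ([] : List ℕ)).union
      (Set.Finite.image2 (fun (n : ℕ) (q : List ℕ) => n :: q) (Set.finite_lt_nat (W + 1)) ih)).subset ?_
    intro q hq
    cases q with
    | nil => exact Or.inl rfl
    | cons n q =>
      have : wt (n :: q) ≤ W + 1 := hq
      simp only [wt] at this
      refine Or.inr ⟨n, ?_, q, ?_, rfl⟩
      · change n < W + 1
        omega
      · change wt q ≤ W
        omega

theorem code_large (W : ℕ) : ∃ N : ℕ, ∀ q : List ℕ, N < Encodable.encode q → W ≤ wt q := by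
  obtain ⟨N, hN⟩ := ((wt_finite W).image Encodable.encode).bddAbove
  refine ⟨N, fun q hq => ?_⟩
  by_contra h
  have := hN ⟨q, (by change wt q ≤ W; omega), rfl⟩
  omega

def tk (m : ℕ) : List ℕ → List ℕ
  | [] => []
  | a :: s => if Encodable.encode (a :: s) ≤ m then a :: s else tk m s

theorem tk_of_le {m : ℕ} {b : List ℕ} (h : Encodable.encode b ≤ m) : tk m b = b := by
  cases b with
  | nil => rfl
  | cons a s => simp only [tk, if_pos h]

theorem tk_close {m : ℕ} {δ : ℝ} (hδ : ∀ q : List ℕ, m < Encodable.encode q → (1/2 : ℝ) ^ (wt q) ≤ δ)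
    (b : List ℕ) : tk m b = b ∨
      (pp (tk m b) ≤ pp b ∧ pp b ≤ pp (tk m b) + 2 * δ - (1/2 : ℝ) ^ (wt b)) := by
  induction b with
  | nil => exact Or.inl rfl
  | cons a s ih =>
    by_cases h : Encodable.encode (a :: s) ≤ m
    · exact Or.inl (tk_of_le h)
    · have h1 := hδ _ (not_le.1 h)
      have h2 := half_step a s
      have h3 : (0:ℝ) ≤ (1/2 : ℝ) ^ (wt (a :: s)) := by positivity
      right
      simp only [tk, if_neg h]
      rw [pp_cons]
      rcases ih with ih | ⟨h4, h5⟩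
      · rw [ih]
        constructor <;> linarith
      · constructor <;> linarith

theorem tk_dist {m : ℕ} {δ : ℝ} (h0 : 0 ≤ δ)
    (hδ : ∀ q : List ℕ, m < Encodable.encode q → (1/2 : ℝ) ^ (wt q) ≤ δ)
    (b : List ℕ) : dist (pI (tk m b)) (pI b) ≤ 2 * δ := by
  rw [Subtype.dist_eq, Real.dist_eq]
  change |pp (tk m b) - pp b| ≤ 2 * δ
  rcases tk_close hδ b with h | ⟨h1, h2⟩
  · rw [h, sub_self, abs_zero]; linarith
  · have h3 : (0:ℝ) ≤ (1/2 : ℝ) ^ (wt b) := by positivity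
    rw [abs_le]
    constructor <;> linarith

/-- Increments of `f` along the tree. -/
noncomputable def inc (f : C(Set.Icc (0:ℝ) 1, ℝ)) : List ℕ → ℝ
  | [] => f (pI [])
  | a :: s => f (pI (a :: s)) - f (pI s)

noncomputable def codes (m : ℕ) : Finset (List ℕ) :=
  ((Set.finite_le_nat m).preimage (f := (Encodable.encode : List ℕ → ℕ))
    Encodable.encode_injective.injOn).toFinset

theorem mem_codes {m : ℕ} {q : List ℕ} : q ∈ codes m ↔ Encodable.encode q ≤ m := by
  simp [codes]

open Classical in
noncomputable def xm (m : ℕ) : C(Set.Icc (0:ℝ) 1, ℝ) →ₗ[ℝ] (List ℕ →₀ ℝ) where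
  toFun f := Finsupp.onFinset (codes m) (fun q => if Encodable.encode q ≤ m then inc f q else 0)
    (fun q hq => by
      rw [mem_codes]
      by_contra h
      exact hq (if_neg h))
  map_add' f g := by
    ext q
    rw [Finsupp.add_apply, Finsupp.onFinset_apply, Finsupp.onFinset_apply, Finsupp.onFinset_apply]
    split_ifs
    · cases q <;> simp [inc] <;> ring
    · simp
  map_smul' c f := by
    ext q
    rw [Finsupp.smul_apply, Finsupp.onFinset_apply, Finsupp.onFinset_apply]
    split_ifs
    · cases q <;> simp [inc] <;> ring
    · simp

theorem xm_apply (m : ℕ) (f : C(Set.Icc (0:ℝ) 1, ℝ)) (q : List ℕ) :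
    xm m f q = if Encodable.encode q ≤ m then inc f q else 0 := by
  simp [xm, Finsupp.onFinset_apply]

theorem ind_br_nil (x : List ℕ →₀ ℝ) : ind (br []) x = x [] := by
  induction x using Finsupp.induction_linear with
  | zero => simp
  | add f g hf hg => simp [hf, hg]
  | single i c =>
    classical
    rw [ind_single, Finsupp.single_apply, Set.indicator_apply]
    by_cases h : i = [] <;> simp [br, h]

theorem ind_xm (m : ℕ) (f : C(Set.Icc (0:ℝ) 1, ℝ)) (b : List ℕ) :
    ind (br b) (xm m f) = f (pI (tk m b)) := by
  induction b with
  | nil => rw [ind_br_nil, xm_apply, if_pos (by simp)]; rfl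
  | cons a s ih =>
    rw [ind_br_cons, ih, xm_apply]
    by_cases h : Encodable.encode (a :: s) ≤ m
    · rw [if_pos h, tk_of_le h, tk_of_le ((encode_tail a s).le.trans h)]
      simp [inc]
    · rw [if_neg h]
      simp only [tk, if_neg h, zero_add]

theorem final {X : Type} [NormedAddCommGroup X] [NormedSpace ℝ X] [CompleteSpace X] {C : ℝ}
    (hC : 0 < C) (v : List ℕ → X) (hL : Lower v Set.univ FA 2)
    (hU : Upper v (spt Set.univ) FA C) : EmbedsInto C(Set.Icc (0:ℝ) 1, ℝ) X := by
  have hU' : ∀ (x : List ℕ →₀ ℝ) (B : ℝ), 0 ≤ B → (∀ b, |ind (br b) x| ≤ B) → ‖LC v x‖ ≤ C * B := by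
    intro x B hB h
    refine hU x (fun i _ => Set.mem_univ i) B hB ?_
    rintro S ⟨b, rfl⟩
    exact h b
  have hL' : ∀ (x : List ℕ →₀ ℝ) (b : List ℕ), |ind (br b) x| ≤ 2 * ‖LC v x‖ := by
    intro x b
    refine hL x ?_ _ ⟨b, rfl⟩
    simp [Finsupp.supported_univ]
  let A : ℕ → C(Set.Icc (0:ℝ) 1, ℝ) →ₗ[ℝ] X := fun m => (LC v).comp (xm m)
  have hA : ∀ m f, A m f = LC v (xm m f) := fun _ _ => rfl
  have hbd : ∀ m f, ‖A m f‖ ≤ C * ‖f‖ := by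
    intro m f
    refine hU' _ _ (norm_nonneg _) fun b => ?_
    rw [ind_xm]
    exact f.norm_coe_le_norm _
  have hcau : ∀ f, CauchySeq fun m => A m f := by
    intro f
    rw [Metric.cauchySeq_iff]
    intro ε hε
    have huc : UniformContinuous f := CompactSpace.uniformContinuous_of_continuous f.continuous
    have hη : 0 < ε / (4 * C) := by positivity
    obtain ⟨δ, hδ, hf⟩ := Metric.uniformContinuous_iff.1 huc _ hη
    obtain ⟨W, hW⟩ := exists_pow_lt_of_lt_one (show 0 < δ / 2 by positivity)
      (by norm_num : (1/2 : ℝ) < 1)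
    obtain ⟨N, hN⟩ := code_large W
    have hcl : ∀ m ≥ N, ∀ b, dist (f (pI (tk m b))) (f (pI b)) < ε / (4 * C) := by
      intro m hm b
      apply hf
      refine lt_of_le_of_lt (tk_dist (δ := (1/2 : ℝ) ^ W) (by positivity) ?_ b) (by linarith)
      intro q hq
      exact pow_le_pow_of_le_one (by norm_num) (by norm_num) (hN q (by omega))
    refine ⟨N, fun m hm m' hm' => ?_⟩
    rw [dist_eq_norm, hA, hA, ← map_sub]
    refine lt_of_le_of_lt (hU' _ (2 * (ε / (4 * C))) (by positivity) fun b => ?_) ?_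
    · rw [map_sub, ind_xm, ind_xm, ← Real.dist_eq]
      have h1 := hcl m hm b
      have h2 := hcl m' hm' b
      rw [dist_comm] at h2
      have h3 := dist_triangle (f (pI (tk m b))) (f (pI b)) (f (pI (tk m' b)))
      linarith
    · have : C * (2 * (ε / (4 * C))) = ε / 2 := by field_simp; norm_num
      rw [this]
      linarith
  choose T hT using fun f => cauchySeq_tendsto_of_complete (hcau f)
  let T0 : C(Set.Icc (0:ℝ) 1, ℝ) →ₗ[ℝ] X :=
    linearMapOfTendsto T A (tendsto_pi_nhds.2 hT)
  have hT0 : ∀ f, T0 f = T f := fun _ => rfl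
  refine ⟨T0.mkContinuous C fun f => ?_, 1/2, by norm_num, fun f => ?_⟩
  · exact le_of_tendsto (hT f).norm (Eventually.of_forall fun m => hbd m f)
  · rw [LinearMap.mkContinuous_apply, hT0]
    have h1 : ∀ b, |f (pI b)| ≤ 2 * ‖T f‖ := by
      intro b
      refine ge_of_tendsto ((hT f).norm.const_mul 2) ?_
      filter_upwards [eventually_ge_atTop (Encodable.encode b)] with m hm
      have := hL' (xm m f) b
      rwa [ind_xm, tk_of_le hm] at this
    have h2 : ∀ z, ‖f z‖ ≤ 2 * ‖T f‖ := by
      intro z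
      have hcl : IsClosed {z | ‖f z‖ ≤ 2 * ‖T f‖} :=
        isClosed_le f.continuous.norm continuous_const
      exact pI_dense.induction_on (p := fun z => ‖f z‖ ≤ 2 * ‖T f‖) z hcl h1
    have h3 := (ContinuousMap.norm_le f (by positivity)).2 h2
    linarith

end ElC

/-- **Main theorem.** A separable infinite dimensional elastic Banach space contains
an isomorphic copy of `C([0,1])`. -/
theorem elastic_contains_C01
    (X : Type) [NormedAddCommGroup X] [NormedSpace ℝ X] [CompleteSpace X]
    [TopologicalSpace.SeparableSpace X]
    (hinf : ¬ FiniteDimensional ℝ X)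
    (K : ℝ) (hK : IsKElastic X K) :
    EmbedsInto C(Set.Icc (0:ℝ) 1, ℝ) X := by
  have h0 : (0:ℝ) ≤ max K 0 := le_max_right _ _
  obtain ⟨v, hL, hU⟩ := ElC.lemma4 (ElC.IsKElastic.mono hK (le_max_left K 0)) h0 hinf
  exact ElC.final (by linarith) v hL hU
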